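/- arXiv:2105.14563 — 3 statements merged into one kernel-verified Lean document; each statement's English description precedes it below -/
import Mathlib

section
/- For every n ∈ ℕ, every real Banach space X, every f : {-1,1}^n → X, every t > 0, every j ∈ {1,…,n} and every ε ∈ {-1,1}^n, one has P_t(D_j f)(ε) = (e^{-t}/√(1−e^{-2t})) · Σ_{η ∈ {-1,1}^n} (Π_{i=1}^n (1 + η_i e^{-t})/2) · ((η_j − e^{-t})/√(1−e^{-2t})) · f(ε·η), where ε·η is the coordinatewise product. -/
open scoped BigOperators
open Finset

noncomputable section

/-- The ±1 value of a Boolean coordinate. -/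
def rad (b : Bool) : ℝ := if b then 1 else -1

/-- Expectation over the uniform measure on the discrete cube `{-1,1}^n`
(points encoded as `Fin n → Bool`). -/
def cubeAvg {n : ℕ} {X : Type*} [AddCommGroup X] [Module ℝ X]
    (f : (Fin n → Bool) → X) : X :=
  ((2 ^ n : ℝ)⁻¹) • ∑ ε : Fin n → Bool, f ε

/-- Walsh character `w_A(ε) = ∏_{i ∈ A} ε_i`. -/
def walshChar {n : ℕ} (A : Finset (Fin n)) (ε : Fin n → Bool) : ℝ :=
  ∏ i ∈ A, rad (ε i)

/-- Walsh coefficient `f̂(A) = E_ε [f(ε) w_A(ε)]`. -/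
def wcoef {n : ℕ} {X : Type*} [AddCommGroup X] [Module ℝ X]
    (f : (Fin n → Bool) → X) (A : Finset (Fin n)) : X :=
  cubeAvg (fun ε => walshChar A ε • f ε)

/-- Flip the `j`-th coordinate. -/
def flipCoord {n : ℕ} (j : Fin n) (ε : Fin n → Bool) : Fin n → Bool :=
  Function.update ε j (!(ε j))

/-- Discrete derivative `D_j f(ε) = (f(ε) - f(σ_j ε))/2`. -/
def Dop {n : ℕ} {X : Type*} [AddCommGroup X] [Module ℝ X]
    (j : Fin n) (f : (Fin n → Bool) → X) : (Fin n → Bool) → X :=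
  fun ε => (2 : ℝ)⁻¹ • (f ε - f (flipCoord j ε))

/-- Heat semigroup `P_t f = Σ_A e^{-t|A|} f̂(A) w_A`. -/
def heatOp {n : ℕ} {X : Type*} [AddCommGroup X] [Module ℝ X]
    (t : ℝ) (f : (Fin n → Bool) → X) : (Fin n → Bool) → X :=
  fun ε => ∑ A : Finset (Fin n), (Real.exp (-t * A.card) * walshChar A ε) • wcoef f A

/-- Fractional power of the Laplacian on mean-zero parts:
`Δ^a f = Σ_{A ≠ ∅} |A|^a f̂(A) w_A`. -/
def lapPow {n : ℕ} {X : Type*} [AddCommGroup X] [Module ℝ X]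
    (a : ℝ) (f : (Fin n → Bool) → X) : (Fin n → Bool) → X :=
  fun ε => ∑ A ∈ Finset.univ.filter (fun A : Finset (Fin n) => A ≠ ∅),
    (((A.card : ℝ)) ^ a * walshChar A ε) • wcoef f A

/-- `X` has cotype `q` with constant `K`. -/
def HasCotypeConst (X : Type*) [NormedAddCommGroup X] [NormedSpace ℝ X] (q K : ℝ) : Prop :=
  ∀ m : ℕ, ∀ x : Fin m → X,
    (∑ j, ‖x j‖ ^ q) ^ (1 / q) ≤
      K * (cubeAvg (fun δ : Fin m → Bool => ‖∑ j, rad (δ j) • x j‖ ^ (2 : ℝ))) ^ (1 / 2 : ℝ)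

/-- `X` has type `s` with constant `T`. -/
def HasTypeConst (X : Type*) [NormedAddCommGroup X] [NormedSpace ℝ X] (s T : ℝ) : Prop :=
  ∀ m : ℕ, ∀ x : Fin m → X,
    (cubeAvg (fun δ : Fin m → Bool => ‖∑ j, rad (δ j) • x j‖ ^ (2 : ℝ))) ^ (1 / 2 : ℝ) ≤
      T * (∑ j, ‖x j‖ ^ s) ^ (1 / s)

lemma aux_rad_beq (a b : Bool) : rad (a == b) = rad a * rad b := by
  cases a <;> cases b <;> simp [rad]

/-- Coordinatewise multiplication by `ε`, as an involution. -/
def auxMul {n : ℕ} (ε : Fin n → Bool) : (Fin n → Bool) ≃ (Fin n → Bool) where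
  toFun η := fun i => ε i == η i
  invFun η := fun i => ε i == η i
  left_inv η := by funext i; cases h : ε i <;> cases hb : η i <;> simp [h, hb]
  right_inv η := by funext i; cases h : ε i <;> cases hb : η i <;> simp [h, hb]

/-- The flip of coordinate `j`, as an involution. -/
def auxFlip {n : ℕ} (j : Fin n) : (Fin n → Bool) ≃ (Fin n → Bool) where
  toFun := flipCoord j
  invFun := flipCoord j
  left_inv η := by simp [flipCoord]
  right_inv η := by simp [flipCoord]

lemma aux_flip_mul {n : ℕ} (j : Fin n) (ε η : Fin n → Bool) :
    flipCoord j (fun i => ε i == η i) = fun i => ε i == flipCoord j η i := by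
  funext i
  by_cases h : i = j
  · subst h
    cases h : ε i <;> cases hb : η i <;> simp [flipCoord, h, hb]
  · simp [flipCoord, h]

lemma aux_heat {n : ℕ} {X : Type*} [AddCommGroup X] [Module ℝ X]
    (g : (Fin n → Bool) → X) (t : ℝ) (ε : Fin n → Bool) :
    heatOp t g ε = ∑ η : Fin n → Bool,
      (∏ i, (1 + rad (η i) * Real.exp (-t)) / 2) • g (fun i => ε i == η i) := by
  have h1 : heatOp t g ε = ∑ δ : Fin n → Bool,
      (∏ i, (1 + (rad (ε i) * rad (δ i)) * Real.exp (-t)) / 2) • g δ := by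
    unfold heatOp wcoef cubeAvg walshChar
    simp only [Finset.smul_sum, smul_smul]
    rw [Finset.sum_comm]
    refine Finset.sum_congr rfl fun δ _ => ?_
    rw [← Finset.sum_smul]
    congr 1
    rw [Finset.prod_div_distrib, Finset.prod_one_add]
    simp only [Finset.prod_const, Finset.card_univ, Fintype.card_fin, Finset.prod_mul_distrib,
      Finset.powerset_univ, Finset.sum_div]
    refine Finset.sum_congr rfl fun A _ => ?_
    rw [mul_comm (-t), Real.exp_nat_mul]
    ring
  rw [h1, ← (auxMul ε).sum_comp]
  refine Finset.sum_congr rfl fun η _ => ?_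
  have h2 : ∀ i, rad (ε i) * rad (auxMul ε η i) = rad (η i) := by
    intro i
    simp only [auxMul, Equiv.coe_fn_mk, aux_rad_beq]
    cases ε i <;> simp [rad]
  simp only [h2]
  rfl

/-- probabilistic representation of `P_t D_j f`. -/
theorem heat_derivative_formula {n : ℕ} {X : Type*} [NormedAddCommGroup X]
    [NormedSpace ℝ X] [CompleteSpace X]
    (f : (Fin n → Bool) → X) (t : ℝ) (ht : 0 < t) (j : Fin n) (ε : Fin n → Bool) :
    heatOp t (Dop j f) ε =
      (Real.exp (-t) / Real.sqrt (1 - Real.exp (-2 * t))) •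
        ∑ η : Fin n → Bool,
          ((∏ i, (1 + rad (η i) * Real.exp (-t)) / 2) *
            ((rad (η j) - Real.exp (-t)) / Real.sqrt (1 - Real.exp (-2 * t)))) •
              f (fun i => ε i == η i) := by
  have hs : 0 < 1 - Real.exp (-2 * t) := by
    have : Real.exp (-2 * t) < 1 := Real.exp_lt_one_iff.mpr (by linarith)
    linarith
  have hsq : Real.sqrt (1 - Real.exp (-2 * t)) ^ 2 = 1 - Real.exp (-t) ^ 2 := by
    rw [Real.sq_sqrt hs.le, ← Real.exp_nat_mul]
    norm_num
  have hpos : Real.sqrt (1 - Real.exp (-2 * t)) ≠ 0 := (Real.sqrt_pos.mpr hs).ne'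
  rw [aux_heat]
  unfold Dop
  simp only [aux_flip_mul, smul_sub, Finset.sum_sub_distrib, Finset.smul_sum, smul_smul]
  rw [← (auxFlip j).sum_comp (fun η : Fin n → Bool =>
    ((∏ i, (1 + rad (η i) * Real.exp (-t)) / 2) * 2⁻¹) •
      f (fun i => ε i == flipCoord j η i)), ← Finset.sum_sub_distrib]
  refine Finset.sum_congr rfl fun η _ => ?_
  have hf : flipCoord j (auxFlip j η) = η := (auxFlip j).left_inv η
  simp only [hf]
  rw [← sub_smul]
  congr 1
  rw [← Finset.mul_prod_erase _ _ (Finset.mem_univ j),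
    ← Finset.mul_prod_erase _ (fun i => (1 + rad (auxFlip j η i) * Real.exp (-t)) / 2)
      (Finset.mem_univ j)]
  have he : ∏ i ∈ Finset.univ.erase j, (1 + rad (auxFlip j η i) * Real.exp (-t)) / 2
      = ∏ i ∈ Finset.univ.erase j, (1 + rad (η i) * Real.exp (-t)) / 2 := by
    refine Finset.prod_congr rfl fun i hi => ?_
    simp [auxFlip, flipCoord, Finset.ne_of_mem_erase hi]
  have hj : rad (auxFlip j η j) = - rad (η j) := by
    cases h : η j <;> simp [auxFlip, flipCoord, rad, h]
  have hr : rad (η j) ^ 2 = 1 := by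
    cases η j <;> simp [rad]
  rw [he, hj]
  generalize (∏ i ∈ Finset.univ.erase j, (1 + rad (η i) * Real.exp (-t)) / 2) = Q
  generalize Real.sqrt (1 - Real.exp (-2 * t)) = S at *
  generalize Real.exp (-t) = e at *
  generalize rad (η j) = r at *
  field_simp
  rw [hsq]
  linear_combination (-2 * Q * e ^ 2 * hr)

end
end

section
/- For every p ∈ [1,2] there is a constant C_p such that for every n ∈ ℕ, every t > 0, and all real-valued functions f_1,…,f_n on {-1,1}^n, one has E_ε|Σ_{i=1}^n D_i P_t f_i(ε)|^p ≤ C_p · (e^{2t}−1)^{-p/2} · E_{δ,ε}|Σ_{i=1}^n δ_i D_i f_i(ε)|^p. -/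
open scoped BigOperators
open Finset

noncomputable section

/-- product weight -/
def hW (w : Bool → ℝ) {n : ℕ} (ξ : Fin n → Bool) : ℝ := ∏ i, w (ξ i)

lemma hsum_succ {n : ℕ} (w : Bool → ℝ) (F : (Fin (n+1) → Bool) → ℝ) :
    ∑ ξ : Fin (n+1) → Bool, hW w ξ * F ξ =
      ∑ ξ : Fin n → Bool, hW w ξ * (w true * F (Fin.cons true ξ) + w false * F (Fin.cons false ξ)) := by
  rw [← (Fin.consEquiv (fun _ : Fin (n+1) => Bool)).sum_comp, Fintype.sum_prod_type]
  rw [Fintype.sum_bool, ← Finset.sum_add_distrib]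
  refine Finset.sum_congr rfl fun ξ _ => ?_
  simp [hW, Fin.consEquiv, Fin.prod_univ_succ]
  ring

lemma hW_sum (w : Bool → ℝ) (hw : w true + w false = 1) (n : ℕ) :
    ∑ ξ : Fin n → Bool, hW w ξ = 1 := by
  induction n with
  | zero => simp [hW]
  | succ n ih =>
    have := hsum_succ (n := n) w (fun _ => 1)
    simp only [mul_one, hw] at this
    rw [this, ih]

lemma hW_moments (w h : Bool → ℝ) (hw : w true + w false = 1)
    (h1 : w true * h true + w false * h false = 0)
    (h2 : w true * h true ^ 2 + w false * h false ^ 2 = 1) (n : ℕ) (x : Fin n → ℝ) :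
    ∑ ξ : Fin n → Bool, hW w ξ * (∑ i, h (ξ i) * x i) ^ 2 = ∑ i, x i ^ 2 := by
  induction n with
  | zero => simp
  | succ n ih =>
    rw [hsum_succ, Fin.sum_univ_succ, ← ih (fun i => x i.succ)]
    have := hW_sum w hw n
    rw [← mul_one (x 0 ^ 2), ← this, Finset.mul_sum, ← Finset.sum_add_distrib]
    refine Finset.sum_congr rfl fun ξ _ => ?_
    simp only [Fin.sum_univ_succ, Fin.cons_zero, Fin.cons_succ]
    generalize ∑ i : Fin n, h (ξ i) * x i.succ = S
    linear_combination hW w ξ * (S ^ 2 * hw + 2 * S * x 0 * h1 + x 0 ^ 2 * h2)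

lemma hW_fourth (n : ℕ) (x : Fin n → ℝ) :
    ∑ ξ : Fin n → Bool, hW (fun _ => 1/2) ξ * (∑ i, rad (ξ i) * x i) ^ 4
      ≤ 3 * (∑ i, x i ^ 2) ^ 2 := by
  induction n with
  | zero => simp
  | succ n ih =>
    rw [hsum_succ, Fin.sum_univ_succ]
    have e0 := hW_sum (fun _ => 1/2) (by norm_num) n
    have e2 := hW_moments (fun _ => 1/2) rad (by norm_num) (by norm_num [rad]) (by norm_num [rad]) n
      (fun i => x i.succ)
    have e4 := ih (fun i => x i.succ)
    have : ∑ ξ : Fin n → Bool, hW (fun _ => 1/2) ξ *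
        (1/2 * (∑ i, rad ((Fin.cons true ξ : Fin (n+1) → Bool) i) * x i) ^ 4
          + 1/2 * (∑ i, rad ((Fin.cons false ξ : Fin (n+1) → Bool) i) * x i) ^ 4)
        = ∑ ξ : Fin n → Bool, hW (fun _ => 1/2) ξ * (∑ i, rad (ξ i) * x i.succ) ^ 4
          + 6 * x 0 ^ 2 * ∑ ξ : Fin n → Bool, hW (fun _ => 1/2) ξ * (∑ i, rad (ξ i) * x i.succ) ^ 2
          + x 0 ^ 4 * ∑ ξ : Fin n → Bool, hW (fun _ => 1/2) ξ := by
      rw [Finset.mul_sum, Finset.mul_sum, ← Finset.sum_add_distrib, ← Finset.sum_add_distrib]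
      refine Finset.sum_congr rfl fun ξ _ => ?_
      simp only [Fin.sum_univ_succ, Fin.cons_zero, Fin.cons_succ, rad, if_true]
      generalize ∑ i : Fin n, _ * x i.succ = S
      simp
      ring
    rw [this, e0, e2]
    nlinarith [sq_nonneg (x 0 ^ 2)]

lemma hW_half {n : ℕ} (ξ : Fin n → Bool) : hW (fun _ => 1/2) ξ = ((2:ℝ)^n)⁻¹ := by
  simp [hW]

lemma hW_khinchine (n : ℕ) (x : Fin n → ℝ) :
    Real.sqrt (∑ i, x i ^ 2) ≤
      2 * ∑ ξ : Fin n → Bool, hW (fun _ => 1/2) ξ * |∑ i, rad (ξ i) * x i| := by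
  have e2 := hW_moments (fun _ => 1/2) rad (by norm_num) (by norm_num [rad]) (by norm_num [rad]) n x
  have e4 := hW_fourth n x
  have hnn : ∀ ξ : Fin n → Bool, 0 ≤ hW (fun _ => 1/2) ξ := fun ξ => by
    rw [hW_half]; positivity
  have hs0 : 0 ≤ ∑ i, x i ^ 2 := Finset.sum_nonneg fun i _ => sq_nonneg _
  set s := Real.sqrt (∑ i, x i ^ 2) with hs
  have hs2 : ∑ i, x i ^ 2 = s ^ 2 := (Real.sq_sqrt hs0).symm
  rw [hs2] at e2 e4
  rcases (Real.sqrt_nonneg (∑ i, x i ^ 2)).eq_or_lt with h | h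
  · rw [← hs] at h
    rw [← h]
    exact mul_nonneg zero_le_two (Finset.sum_nonneg fun ξ _ => mul_nonneg (hnn ξ) (abs_nonneg _))
  · rw [← hs] at h
    have key : ∀ S : ℝ, s ^ 2 * S ^ 2 - S ^ 4 / 6 ≤ s ^ 3 * |S| := by
      intro S
      have : ∀ u : ℝ, 0 ≤ u → s ^ 2 * u ^ 2 - u ^ 4 / 6 ≤ s ^ 3 * u := by
        intro u hu
        have : 0 ≤ u ^ 3 / 6 - s ^ 2 * u + s ^ 3 := by
          nlinarith [mul_nonneg (by positivity : 0 ≤ u + 3 * s) (sq_nonneg (u - 3/2 * s)),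
            mul_nonneg (by positivity : 0 ≤ u + 2 * s) (sq_nonneg (u - 7/5 * s)),
            mul_nonneg (by positivity : 0 ≤ u + 14/5 * s) (sq_nonneg (u - 7/5 * s)),
            mul_nonneg hu (sq_nonneg (u - 7/5 * s)), pow_pos h 3, mul_nonneg hu (sq_nonneg s), mul_nonneg h.le (sq_nonneg (u - 7/5 * s))]
        nlinarith [mul_nonneg hu this]
      have := this |S| (abs_nonneg _)
      rwa [sq_abs, show |S| ^ 4 = S ^ 4 from by
        rw [show |S| ^ 4 = (|S| ^ 2) ^ 2 by ring, sq_abs]; ring] at this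
    have hsum : s ^ 2 * ∑ ξ : Fin n → Bool, hW (fun _ => 1/2) ξ * (∑ i, rad (ξ i) * x i) ^ 2
        - (∑ ξ : Fin n → Bool, hW (fun _ => 1/2) ξ * (∑ i, rad (ξ i) * x i) ^ 4) / 6
        ≤ s ^ 3 * ∑ ξ : Fin n → Bool, hW (fun _ => 1/2) ξ * |∑ i, rad (ξ i) * x i| := by
      rw [Finset.mul_sum, Finset.mul_sum, Finset.sum_div, ← Finset.sum_sub_distrib]
      refine Finset.sum_le_sum fun ξ _ => ?_
      have := mul_le_mul_of_nonneg_left (key (∑ i, rad (ξ i) * x i)) (hnn ξ)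
      linarith
    rw [e2] at hsum
    have : s ^ 3 * s ≤ s ^ 3 * (2 * ∑ ξ : Fin n → Bool, hW (fun _ => 1/2) ξ * |∑ i, rad (ξ i) * x i|) := by
      nlinarith
    exact le_of_mul_le_mul_left this (by positivity)

/-- pointwise product on the cube -/
def cmul {n : ℕ} (ε ξ : Fin n → Bool) : Fin n → Bool := fun i => (ε i == ξ i)

lemma cmul_comm' {n : ℕ} (ε ξ : Fin n → Bool) : cmul ε ξ = cmul ξ ε := by
  funext i; simp only [cmul]; cases ε i <;> cases ξ i <;> rfl

lemma cmul_cmul {n : ℕ} (ε ξ : Fin n → Bool) : cmul ε (cmul ε ξ) = ξ := by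
  funext i; simp only [cmul]; cases ε i <;> cases ξ i <;> rfl

lemma sum_cmul {n : ℕ} (ε : Fin n → Bool) (F : (Fin n → Bool) → ℝ) :
    ∑ ξ, F (cmul ε ξ) = ∑ ξ, F ξ :=
  Equiv.sum_comp (Function.Involutive.toPerm (cmul ε) (cmul_cmul ε)) F

lemma flipCoord_flip {n : ℕ} (i : Fin n) (ε : Fin n → Bool) : flipCoord i (flipCoord i ε) = ε := by
  simp [flipCoord]

lemma cmul_flip {n : ℕ} (i : Fin n) (ε ξ : Fin n → Bool) :
    cmul ε (flipCoord i ξ) = flipCoord i (cmul ε ξ) := by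
  funext j
  by_cases hj : j = i
  · subst hj
    simp only [cmul, flipCoord, Function.update_self]; cases ε j <;> cases ξ j <;> rfl
  · simp [cmul, flipCoord, Function.update_of_ne hj]

lemma sum_flip {n : ℕ} (i : Fin n) (F : (Fin n → Bool) → ℝ) :
    ∑ ξ, F (flipCoord i ξ) = ∑ ξ, F ξ :=
  Equiv.sum_comp (Function.Involutive.toPerm (flipCoord i) (flipCoord_flip i)) F

/-- heat weight -/
def hwt (q : ℝ) (b : Bool) : ℝ := (1 + q * rad b) / 2

lemma heat_rep {n : ℕ} (t : ℝ) (f : (Fin n → Bool) → ℝ) (ε : Fin n → Bool) :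
    heatOp t f ε = ∑ ξ, hW (hwt (Real.exp (-t))) ξ * f (cmul ε ξ) := by
  rw [← sum_cmul ε (fun ξ => hW (hwt (Real.exp (-t))) ξ * f (cmul ε ξ))]
  simp only [cmul_cmul, heatOp, wcoef, cubeAvg, smul_eq_mul, Finset.mul_sum]
  rw [Finset.sum_comm]
  refine Finset.sum_congr rfl fun ξ _ => ?_
  have hr : ∀ i, rad (cmul ε ξ i) = rad (ε i) * rad (ξ i) := by
    intro i; simp only [cmul]; cases ε i <;> cases ξ i <;> simp [rad]
  have : hW (hwt (Real.exp (-t))) (cmul ε ξ) = ((2:ℝ)^n)⁻¹ *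
      ∑ A : Finset (Fin n), ∏ i ∈ A, (Real.exp (-t) * (rad (ε i) * rad (ξ i))) := by
    simp only [hW, hwt, hr]
    rw [Finset.prod_div_distrib, Finset.prod_one_add]
    simp [div_eq_inv_mul]
  rw [this, mul_assoc, Finset.sum_mul, Finset.mul_sum]
  refine Finset.sum_congr rfl fun A _ => ?_
  simp only [walshChar, Finset.prod_mul_distrib, Finset.prod_const]
  rw [← Real.exp_nat_mul, mul_comm (A.card : ℝ) (-t)]
  ring

lemma Dop_flip {n : ℕ} (i : Fin n) (f : (Fin n → Bool) → ℝ) (ε : Fin n → Bool) :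
    Dop i f (flipCoord i ε) = - Dop i f ε := by
  simp only [Dop, flipCoord_flip, smul_eq_mul]; ring

lemma D_heat {n : ℕ} (t : ℝ) (i : Fin n) (f : (Fin n → Bool) → ℝ) (ε : Fin n → Bool) :
    Dop i (heatOp t f) ε = ∑ ξ, hW (hwt (Real.exp (-t))) ξ * Dop i f (cmul ε ξ) := by
  simp only [Dop, heat_rep, smul_eq_mul]
  rw [← Finset.sum_sub_distrib, Finset.mul_sum]
  refine Finset.sum_congr rfl fun ξ _ => ?_
  rw [cmul_comm' (flipCoord i ε), cmul_flip, cmul_comm' ξ]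
  ring

lemma flip_sum {n : ℕ} (q : ℝ) (hq : 1 - q ^ 2 ≠ 0) (i : Fin n) (g : (Fin n → Bool) → ℝ)
    (hg : ∀ ε, g (flipCoord i ε) = - g ε) (ε : Fin n → Bool) :
    ∑ ξ, hW (hwt q) ξ * g (cmul ε ξ) =
      ∑ ξ, hW (hwt q) ξ * ((q * (rad (ξ i) - q) / (1 - q ^ 2)) * g (cmul ε ξ)) := by
  rw [← sub_eq_zero, ← Finset.sum_sub_distrib]
  set T : (Fin n → Bool) → ℝ := fun ξ => hW (hwt q) ξ * g (cmul ε ξ) -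
    hW (hwt q) ξ * ((q * (rad (ξ i) - q) / (1 - q ^ 2)) * g (cmul ε ξ)) with hT
  have hTe : ∀ ξ, T ξ = 1/2 * (∏ j ∈ univ.erase i, hwt q (ξ j)) * g (cmul ε ξ) := by
    intro ξ
    have h1 : hW (hwt q) ξ = hwt q (ξ i) * ∏ j ∈ univ.erase i, hwt q (ξ j) :=
      (Finset.mul_prod_erase univ (fun j => hwt q (ξ j)) (Finset.mem_univ i)).symm
    have h2 : hwt q (ξ i) * (1 - q * (rad (ξ i) - q) / (1 - q ^ 2)) = 1/2 := by
      cases ξ i <;> simp [hwt, rad] <;> field_simp <;> ring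
    simp only [hT]
    rw [h1, ← h2]; ring
  have hneg : ∀ ξ, T (flipCoord i ξ) = - T ξ := by
    intro ξ
    rw [hTe, hTe, cmul_flip, hg]
    have : ∏ j ∈ univ.erase i, hwt q (flipCoord i ξ j) = ∏ j ∈ univ.erase i, hwt q (ξ j) := by
      refine Finset.prod_congr rfl fun j hj => ?_
      rw [flipCoord, Function.update_of_ne (Finset.ne_of_mem_erase hj)]
    rw [this]; ring
  have := sum_flip i T
  simp only [hneg, Finset.sum_neg_distrib] at this
  linarith

lemma jensen_abs {ι : Type*} [Fintype ι] (w z : ι → ℝ) (hw : ∀ i, 0 ≤ w i) (hs : ∑ i, w i = 1)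
    (p : ℝ) (hp : 1 ≤ p) : |∑ i, w i * z i| ^ p ≤ ∑ i, w i * |z i| ^ p := by
  refine le_trans (Real.rpow_le_rpow (abs_nonneg _) (Finset.abs_sum_le_sum_abs _ _) (by linarith)) ?_
  simp only [abs_mul, abs_of_nonneg (hw _)]
  exact Real.rpow_arith_mean_le_arith_mean_rpow univ w (fun i => |z i|) (fun i _ => hw i) hs
    (fun i _ => abs_nonneg _) hp

lemma moment_cmp (w h : Bool → ℝ) (hw0 : ∀ b, 0 ≤ w b) (hw : w true + w false = 1)
    (h1 : w true * h true + w false * h false = 0)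
    (h2 : w true * h true ^ 2 + w false * h false ^ 2 = 1) (n : ℕ) (x : Fin n → ℝ)
    (p : ℝ) (hp1 : 1 ≤ p) (hp2 : p ≤ 2) :
    ∑ ξ : Fin n → Bool, hW w ξ * |∑ i, h (ξ i) * x i| ^ p ≤
      2 ^ p * cubeAvg (fun δ : Fin n → Bool => |∑ i, rad (δ i) * x i| ^ p) := by
  have hp0 : 0 < p := by linarith
  have hs0 : 0 ≤ ∑ i, x i ^ 2 := Finset.sum_nonneg fun i _ => sq_nonneg _
  have hA0 : 0 ≤ ∑ ξ : Fin n → Bool, hW w ξ * |∑ i, h (ξ i) * x i| ^ p :=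
    Finset.sum_nonneg fun ξ _ => mul_nonneg (Finset.prod_nonneg fun i _ => hw0 _)
      (Real.rpow_nonneg (abs_nonneg _) _)
  have hA : (∑ ξ : Fin n → Bool, hW w ξ * |∑ i, h (ξ i) * x i| ^ p) ^ (2 / p) ≤ ∑ i, x i ^ 2 := by
    rw [← hW_moments w h hw h1 h2 n x]
    refine le_trans (Real.rpow_arith_mean_le_arith_mean_rpow univ (hW w) _
      (fun i _ => Finset.prod_nonneg fun i _ => hw0 _) (hW_sum w hw n)
      (fun i _ => Real.rpow_nonneg (abs_nonneg _) _) ((one_le_div hp0).2 hp2)) ?_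
    refine le_of_eq (Finset.sum_congr rfl fun ξ _ => ?_)
    rw [← Real.rpow_mul (abs_nonneg _), mul_div_cancel₀ _ hp0.ne', Real.rpow_two, sq_abs]
  have hB : ∑ ξ : Fin n → Bool, hW w ξ * |∑ i, h (ξ i) * x i| ^ p ≤ Real.sqrt (∑ i, x i ^ 2) ^ p := by
    have := Real.rpow_le_rpow (Real.rpow_nonneg hA0 _) hA (by positivity : 0 ≤ p / 2)
    rw [← Real.rpow_mul hA0, show 2 / p * (p / 2) = 1 by field_simp, Real.rpow_one] at this
    refine this.trans (le_of_eq ?_)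
    rw [Real.sqrt_eq_rpow, ← Real.rpow_mul hs0]; congr 1; ring
  refine hB.trans ?_
  have hk := hW_khinchine n x
  have hnn : ∀ ξ : Fin n → Bool, 0 ≤ hW (fun _ => 1/2) ξ := fun ξ => by
    rw [hW_half]; positivity
  have hE0 : 0 ≤ ∑ ξ : Fin n → Bool, hW (fun _ => 1/2) ξ * |∑ i, rad (ξ i) * x i| :=
    Finset.sum_nonneg fun ξ _ => mul_nonneg (hnn ξ) (abs_nonneg _)
  refine (Real.rpow_le_rpow (Real.sqrt_nonneg _) hk hp0.le).trans ?_
  rw [Real.mul_rpow zero_le_two hE0]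
  refine mul_le_mul_of_nonneg_left ?_ (by positivity)
  refine (Real.rpow_arith_mean_le_arith_mean_rpow univ (hW (fun _ => 1/2)) _
      (fun i _ => hnn i) (hW_sum _ (by norm_num) n)
      (fun i _ => abs_nonneg _) hp1).trans (le_of_eq ?_)
  simp only [cubeAvg, hW_half, smul_eq_mul, Finset.mul_sum]

/-- scalar estimate `E|Σ D_i P_t f_i|^p ≤ C_p (e^{2t}-1)^{-p/2}
E_{δ,ε}|Σ δ_i D_i f_i|^p` for `1 ≤ p ≤ 2`. -/
theorem scalar_heat_estimate (p : ℝ) (hp1 : 1 ≤ p) (hp2 : p ≤ 2) :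
    ∃ C : ℝ, ∀ (n : ℕ) (t : ℝ), 0 < t →
      ∀ f : Fin n → (Fin n → Bool) → ℝ,
        cubeAvg (fun ε => |∑ i, Dop i (heatOp t (f i)) ε| ^ p) ≤
          C * (Real.exp (2 * t) - 1) ^ (-(p / 2)) *
            cubeAvg (fun δ : Fin n → Bool => cubeAvg (fun ε =>
              |∑ i, rad (δ i) * Dop i (f i) ε| ^ p)) := by
  refine ⟨2 ^ p, fun n t ht f => ?_⟩
  have hp0 : 0 < p := by linarith
  set q := Real.exp (-t) with hq
  have hq0 : 0 < q := Real.exp_pos _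
  have hq1 : q < 1 := by rw [hq, Real.exp_lt_one_iff]; linarith
  have hd : 0 < 1 - q ^ 2 := by nlinarith
  set r := Real.sqrt (1 - q ^ 2) with hr
  have hr0 : 0 < r := Real.sqrt_pos.2 hd
  have hr2 : r ^ 2 = 1 - q ^ 2 := Real.sq_sqrt hd.le
  set h : Bool → ℝ := fun b => (rad b - q) / r with hh
  have hw0 : ∀ b, 0 ≤ hwt q b := by
    intro b; cases b <;> simp [hwt, rad] <;> linarith
  have hw : hwt q true + hwt q false = 1 := by simp [hwt, rad]; ring
  have h1 : hwt q true * h true + hwt q false * h false = 0 := by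
    simp [hwt, rad, hh]; field_simp; ring
  have h2 : hwt q true * h true ^ 2 + hwt q false * h false ^ 2 = 1 := by
    simp [hwt, rad, hh]; field_simp; rw [hr2]; ring
  have hrep : ∀ ε, ∑ i, Dop i (heatOp t (f i)) ε =
      (q / r) * ∑ ξ, hW (hwt q) ξ * ∑ i, h (ξ i) * Dop i (f i) (cmul ε ξ) := by
    intro ε
    simp only [D_heat, ← hq]
    rw [Finset.sum_congr rfl fun i _ => flip_sum q hd.ne' i (Dop i (f i)) (Dop_flip i (f i)) ε,
      Finset.sum_comm, Finset.mul_sum]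
    refine Finset.sum_congr rfl fun ξ _ => ?_
    rw [Finset.mul_sum, Finset.mul_sum]
    refine Finset.sum_congr rfl fun i _ => ?_
    rw [← hr2]; simp only [hh]; field_simp
  have hconst : (q / r) ^ p = (Real.exp (2 * t) - 1) ^ (-(p / 2)) := by
    have e1 : (q / r) ^ 2 = (Real.exp (2 * t) - 1)⁻¹ := by
      have : Real.exp (2 * t) * q ^ 2 = 1 := by
        rw [hq, ← Real.exp_nat_mul, ← Real.exp_add]; simp
      have h3 : Real.exp (2 * t) - 1 ≠ 0 := by
        have : 1 < Real.exp (2 * t) := Real.one_lt_exp_iff.2 (by linarith)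
        linarith
      rw [div_pow, hr2, div_eq_iff hd.ne', eq_comm, inv_mul_eq_iff_eq_mul₀ h3]
      linarith
    have h3 : 0 ≤ Real.exp (2 * t) - 1 := by
      have : 1 < Real.exp (2 * t) := Real.one_lt_exp_iff.2 (by linarith)
      linarith
    rw [Real.rpow_neg h3, ← Real.inv_rpow h3, ← e1, ← Real.rpow_two, ← Real.rpow_mul (by positivity)]
    congr 1; ring
  rw [mul_comm (2 ^ p : ℝ), mul_assoc, ← hconst]
  have hstep : ∀ ε, |∑ i, Dop i (heatOp t (f i)) ε| ^ p ≤
      (q / r) ^ p * ∑ ξ, hW (hwt q) ξ * |∑ i, h (ξ i) * Dop i (f i) (cmul ε ξ)| ^ p := by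
    intro ε
    rw [hrep, abs_mul, abs_of_pos (by positivity : 0 < q / r),
      Real.mul_rpow (by positivity) (abs_nonneg _)]
    exact mul_le_mul_of_nonneg_left (jensen_abs _ _ (fun ξ => Finset.prod_nonneg fun i _ => hw0 _)
      (hW_sum _ hw n) p hp1) (by positivity)
  have hswap : ∑ ε, ∑ ξ, hW (hwt q) ξ * |∑ i, h (ξ i) * Dop i (f i) (cmul ε ξ)| ^ p =
      ∑ ε, ∑ ξ : Fin n → Bool, hW (hwt q) ξ * |∑ i, h (ξ i) * Dop i (f i) ε| ^ p := by
    rw [Finset.sum_comm, Finset.sum_comm (s := univ) (t := univ)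
      (f := fun (ε ξ : Fin n → Bool) => hW (hwt q) ξ * |∑ i, h (ξ i) * Dop i (f i) ε| ^ p)]
    refine Finset.sum_congr rfl fun ξ _ => ?_
    rw [← sum_cmul ξ]
    simp only [cmul_comm' _ ξ, cmul_cmul]
  have hfin : ∑ ε, |∑ i, Dop i (heatOp t (f i)) ε| ^ p ≤ (q / r) ^ p * (2 ^ p *
      ∑ ε, cubeAvg (fun δ : Fin n → Bool => |∑ i, rad (δ i) * Dop i (f i) ε| ^ p)) := by
    refine (Finset.sum_le_sum fun ε _ => hstep ε).trans ?_
    rw [← Finset.mul_sum, hswap, Finset.mul_sum (a := (2 ^ p : ℝ))]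
    refine mul_le_mul_of_nonneg_left (Finset.sum_le_sum fun ε _ => ?_) (by positivity)
    exact moment_cmp _ h hw0 hw h1 h2 n _ p hp1 hp2
  have := mul_le_mul_of_nonneg_left hfin (by positivity : (0:ℝ) ≤ (2 ^ n)⁻¹)
  refine le_trans (le_of_eq ?_) (this.trans (le_of_eq ?_))
  · simp [cubeAvg]
  · simp only [cubeAvg, smul_eq_mul]
    rw [← Finset.mul_sum, ← Finset.mul_sum, Finset.sum_comm]
    ring

end
end

section
/- There is a universal constant C such that for every p ∈ [2,∞), every n ∈ ℕ, and all real-valued functions f_1,…,f_n on {-1,1}^n, one has ‖Σ_{i=1}^n Δ^{-1/2} D_i f_i‖_{L^p} ≤ C · p^{3/2} · ‖(Σ_{i=1}^n (D_i f_i)²)^{1/2}‖_{L^p}, where L^p-norms are taken with respect to the uniform probability measure on {-1,1}^n. -/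
open scoped BigOperators
open Finset

noncomputable section

open scoped BigOperators
open Finset

noncomputable section

namespace EPR

open Matrix

variable {N : Type*} [Fintype N] [DecidableEq N]

/-- finite `ℓ^p` norm. -/
def lpn {ι : Type*} [Fintype ι] (p : ℝ) (u : ι → ℝ) : ℝ := (∑ a, |u a| ^ p) ^ (1 / p)

lemma lpn_nonneg {ι : Type*} [Fintype ι] (p : ℝ) (u : ι → ℝ) : 0 ≤ lpn p u :=
  Real.rpow_nonneg (Finset.sum_nonneg fun _ _ => Real.rpow_nonneg (abs_nonneg _) _) _

lemma lpn_rpow {ι : Type*} [Fintype ι] {p : ℝ} (hp : 0 < p) (u : ι → ℝ) :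
    lpn p u ^ p = ∑ a, |u a| ^ p := by
  unfold lpn
  rw [← Real.rpow_mul (Finset.sum_nonneg fun _ _ => Real.rpow_nonneg (abs_nonneg _) _),
    one_div_mul_cancel hp.ne', Real.rpow_one]

lemma lpn_le_of {ι κ : Type*} [Fintype ι] [Fintype κ] {p : ℝ} (hp : 0 < p) (u : ι → ℝ) (v : κ → ℝ)
    (h : ∑ a, |u a| ^ p ≤ ∑ a, |v a| ^ p) : lpn p u ≤ lpn p v := by
  unfold lpn
  exact Real.rpow_le_rpow (Finset.sum_nonneg fun _ _ => Real.rpow_nonneg (abs_nonneg _) _) h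
    (by positivity)

/-- unitarity -/
def IsU (U : Matrix N N ℂ) : Prop := Uᴴ * U = 1 ∧ U * Uᴴ = 1

lemma IsU.mul {U V : Matrix N N ℂ} (hU : IsU U) (hV : IsU V) : IsU (U * V) := by
  constructor
  · rw [conjTranspose_mul, Matrix.mul_assoc, ← Matrix.mul_assoc Uᴴ, hU.1, Matrix.one_mul, hV.1]
  · rw [conjTranspose_mul, Matrix.mul_assoc, ← Matrix.mul_assoc V, hV.2, Matrix.one_mul, hU.2]

lemma IsU.star {U : Matrix N N ℂ} (hU : IsU U) : IsU Uᴴ := by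
  constructor
  · rw [conjTranspose_conjTranspose]; exact hU.2
  · rw [conjTranspose_conjTranspose]; exact hU.1

lemma isU_one : IsU (1 : Matrix N N ℂ) := by constructor <;> simp

lemma IsU.row {U : Matrix N N ℂ} (hU : IsU U) (x : N) : ∑ a, Complex.normSq (U x a) = 1 := by
  have h := congrFun (congrFun hU.2 x) x
  rw [Matrix.mul_apply, one_apply_eq] at h
  simp only [conjTranspose_apply, RCLike.star_def, Complex.mul_conj] at h
  exact_mod_cast h

lemma IsU.col {U : Matrix N N ℂ} (hU : IsU U) (a : N) : ∑ x, Complex.normSq (U x a) = 1 := by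
  have h := hU.star.row a
  simpa [conjTranspose_apply] using h

/-- functional calculus matrix -/
def fc (U : Matrix N N ℂ) (l : N → ℝ) : Matrix N N ℂ :=
  U * diagonal (fun a => (l a : ℂ)) * Uᴴ

lemma fc_apply (U : Matrix N N ℂ) (l : N → ℝ) (x y : N) :
    fc U l x y = ∑ a, U x a * l a * star (U y a) := by
  simp [fc, Matrix.mul_apply, Matrix.diagonal_apply]

lemma fc_diag (U : Matrix N N ℂ) (l : N → ℝ) (x : N) :
    fc U l x x = ((∑ a, Complex.normSq (U x a) * l a : ℝ) : ℂ) := by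
  rw [fc_apply]
  push_cast
  refine Finset.sum_congr rfl fun a _ => ?_
  rw [← Complex.mul_conj]
  simp only [RCLike.star_def]; ring

lemma fc_conj (V U : Matrix N N ℂ) (l : N → ℝ) : V * fc U l * Vᴴ = fc (V * U) l := by
  simp [fc, Matrix.mul_assoc]

lemma fc_mul {U : Matrix N N ℂ} (hU : IsU U) (l m : N → ℝ) :
    fc U l * fc U m = fc U (fun a => l a * m a) := by
  have : fc U l * fc U m
      = U * diagonal (fun a => (l a : ℂ)) * (Uᴴ * U) * diagonal (fun a => (m a : ℂ)) * Uᴴ := by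
    simp only [fc, Matrix.mul_assoc]
  rw [this, hU.1, Matrix.mul_one, Matrix.mul_assoc U, diagonal_mul_diagonal]
  simp [fc]

lemma fc_one {U : Matrix N N ℂ} (hU : IsU U) : fc U (fun _ => 1) = 1 := by
  have : (diagonal fun _ : N => ((1 : ℝ) : ℂ)) = 1 := by simp
  rw [fc, this, Matrix.mul_one, hU.2]

lemma fc_pow {U : Matrix N N ℂ} (hU : IsU U) (l : N → ℝ) (k : ℕ) :
    fc U l ^ k = fc U (fun a => l a ^ k) := by
  induction k with
  | zero => simp [fc_one hU]
  | succ k ih => rw [pow_succ, ih, fc_mul hU]; simp only [pow_succ]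

lemma fc_herm (U : Matrix N N ℂ) (l : N → ℝ) : (fc U l).IsHermitian := by
  unfold Matrix.IsHermitian fc
  rw [conjTranspose_mul, conjTranspose_mul, conjTranspose_conjTranspose, diagonal_conjTranspose,
    Matrix.mul_assoc]
  congr 3
  ext a; simp

lemma trace_fc {U : Matrix N N ℂ} (hU : IsU U) (l : N → ℝ) :
    trace (fc U l) = ((∑ a, l a : ℝ) : ℂ) := by
  rw [fc, trace_mul_comm, ← Matrix.mul_assoc, hU.1, Matrix.one_mul, trace_diagonal]
  push_cast; rfl

lemma spectral {X : Matrix N N ℂ} (hX : X.IsHermitian) :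
    ∃ U : Matrix N N ℂ, IsU U ∧ ∃ l : N → ℝ, X = fc U l := by
  refine ⟨hX.eigenvectorUnitary, ⟨?_, ?_⟩, hX.eigenvalues, ?_⟩
  · exact Unitary.coe_star_mul_self hX.eigenvectorUnitary
  · exact Unitary.coe_mul_star_self hX.eigenvectorUnitary
  · conv_lhs => rw [hX.spectral_theorem]
    rw [Unitary.conjStarAlgAut_apply]
    rfl

lemma trace_mul_fc (X V : Matrix N N ℂ) (y : N → ℝ) :
    trace (X * fc V y) = ∑ a, (Vᴴ * X * V) a a * y a := by
  have : trace (X * fc V y) = trace (Vᴴ * X * V * diagonal (fun a => (y a : ℂ))) := by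
    rw [fc, ← Matrix.mul_assoc, trace_mul_comm]
    simp only [Matrix.mul_assoc]
  rw [this, trace]
  simp [Matrix.mul_apply, diagonal_apply]

lemma diag_le {U : Matrix N N ℂ} (hU : IsU U) (l : N → ℝ) {p : ℝ} (hp : 1 ≤ p) :
    lpn p (fun x => (fc U l x x).re) ≤ lpn p l := by
  apply lpn_le_of (by linarith)
  calc ∑ x, |(fc U l x x).re| ^ p
      ≤ ∑ x, ∑ a, Complex.normSq (U x a) * |l a| ^ p := by
        refine Finset.sum_le_sum fun x _ => ?_
        rw [fc_diag, Complex.ofReal_re]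
        refine le_trans ?_ (Real.rpow_arith_mean_le_arith_mean_rpow univ
          (fun a => Complex.normSq (U x a)) (fun a => |l a|)
          (fun a _ => Complex.normSq_nonneg _) (hU.row x) (fun a _ => abs_nonneg _) hp)
        refine Real.rpow_le_rpow (abs_nonneg _) ?_ (by linarith)
        refine (Finset.abs_sum_le_sum_abs _ _).trans (le_of_eq ?_)
        refine Finset.sum_congr rfl fun a _ => ?_
        rw [abs_mul, abs_of_nonneg (Complex.normSq_nonneg _)]
    _ = ∑ a, |l a| ^ p := by
        rw [Finset.sum_comm]
        refine Finset.sum_congr rfl fun a _ => ?_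
        rw [← Finset.sum_mul, hU.col a, one_mul]

lemma holder {U V : Matrix N N ℂ} (hU : IsU U) (hV : IsU V) (l y : N → ℝ) {p q : ℝ}
    (hpq : p.HolderConjugate q) :
    (trace (fc U l * fc V y)).re ≤ lpn p l * lpn q y := by
  have h1 : (trace (fc U l * fc V y)).re = ∑ a, (fc (Vᴴ * U) l a a).re * y a := by
    rw [trace_mul_fc, Complex.re_sum]
    refine Finset.sum_congr rfl fun a _ => ?_
    have := fc_conj Vᴴ U l
    rw [conjTranspose_conjTranspose] at this
    rw [this, Complex.re_mul_ofReal]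
  rw [h1]
  refine (Real.inner_le_Lp_mul_Lq univ _ _ hpq).trans ?_
  exact mul_le_mul_of_nonneg_right (diag_le (hV.star.mul hU) l hpq.lt.le) (lpn_nonneg q y)

end EPR
end

open scoped BigOperators
open Finset

noncomputable section
set_option linter.unusedSectionVars false
set_option linter.unusedSimpArgs false

namespace EPR

open Matrix

variable {N : Type*} [Fintype N] [DecidableEq N]

lemma lpn_comp_rpow {ι : Type*} [Fintype ι] {q r R : ℝ} (hq : 0 < q) (hR : 0 < R) (h : r * q = R)
    (m : ι → ℝ) : lpn q (fun a => |m a| ^ r) = lpn R m ^ r := by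
  have h0 : (0 : ℝ) ≤ ∑ a, |m a| ^ R :=
    Finset.sum_nonneg fun _ _ => Real.rpow_nonneg (abs_nonneg _) _
  unfold lpn
  rw [← Real.rpow_mul h0]
  congr 1
  · refine Finset.sum_congr rfl fun a _ => ?_
    rw [abs_of_nonneg (Real.rpow_nonneg (abs_nonneg _) _), ← Real.rpow_mul (abs_nonneg _), h]
  · field_simp; linarith

lemma trace_fc_nonneg {U V : Matrix N N ℂ} {l y : N → ℝ} (hl : ∀ a, 0 ≤ l a) (hy : ∀ a, 0 ≤ y a) :
    0 ≤ (trace (fc U l * fc V y)).re := by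
  rw [trace_mul_fc, Complex.re_sum]
  refine Finset.sum_nonneg fun a _ => ?_
  have := fc_conj Vᴴ U l
  rw [conjTranspose_conjTranspose] at this
  rw [this, Complex.re_mul_ofReal, fc_diag, Complex.ofReal_re]
  exact mul_nonneg (Finset.sum_nonneg fun b _ => mul_nonneg (Complex.normSq_nonneg _) (hl b)) (hy a)

lemma sq_diag_nonneg {R : Matrix N N ℂ} (hR : R.IsHermitian) (Z : Matrix N N ℂ) (a : N) :
    0 ≤ ((Zᴴ * (R * R) * Z) a a).re := by
  have : Zᴴ * (R * R) * Z = (R * Z)ᴴ * (R * Z) := by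
    rw [conjTranspose_mul, hR.eq]; simp only [Matrix.mul_assoc]
  rw [this, Matrix.mul_apply, Complex.re_sum]
  refine Finset.sum_nonneg fun b _ => ?_
  rw [conjTranspose_apply, RCLike.star_def, mul_comm, Complex.mul_conj, Complex.ofReal_re]
  exact Complex.normSq_nonneg _

/-- matrix Hilbert transform -/
def Hs (d : N → ℤ) (X : Matrix N N ℂ) : Matrix N N ℂ :=
  Matrix.of fun a b => -Complex.I * (Int.sign (d a - d b) : ℂ) * X a b

/-- zero frequency part -/
def Z0 (d : N → ℤ) (X : Matrix N N ℂ) : Matrix N N ℂ :=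
  Matrix.of fun a b => if d a = d b then X a b else 0

lemma Hs_herm (d : N → ℤ) {X : Matrix N N ℂ} (hX : X.IsHermitian) : (Hs d X).IsHermitian := by
  ext a b
  have h := hX.apply a b
  simp only [conjTranspose_apply, Hs, of_apply, star_mul']
  rw [h]
  have : Int.sign (d b - d a) = - Int.sign (d a - d b) := by
    rw [← neg_sub, Int.sign_neg]
  rw [this]
  simp

lemma Z0_herm (d : N → ℤ) {X : Matrix N N ℂ} (hX : X.IsHermitian) : (Z0 d X).IsHermitian := by
  ext a b
  have h := hX.apply a b
  simp only [conjTranspose_apply, Z0, of_apply]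
  by_cases hab : d a = d b
  · rw [if_pos hab, if_pos hab.symm, h]
  · rw [if_neg hab, if_neg (fun h => hab h.symm)]; simp

lemma sgn_id (x y z : ℤ) :
    -(Int.sign (x - y) * Int.sign (y - z))
      = 1 - Int.sign (x - z) * (Int.sign (x - y) + Int.sign (y - z))
        - (if x = y then 1 else 0) * (if y = z then 1 else 0) := by
  have key : ∀ u : ℤ, (0 < u ∧ Int.sign u = 1) ∨ (u = 0 ∧ Int.sign u = 0)
      ∨ (u < 0 ∧ Int.sign u = -1) := by
    intro u
    rcases lt_trichotomy u 0 with h | h | h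
    · right; right; exact ⟨h, Int.sign_eq_neg_one_of_neg h⟩
    · right; left; exact ⟨h, by simp [h]⟩
    · left; exact ⟨h, Int.sign_eq_one_of_pos h⟩
  rcases key (x - y) with ⟨h1, e1⟩ | ⟨h1, e1⟩ | ⟨h1, e1⟩ <;>
  rcases key (y - z) with ⟨h2, e2⟩ | ⟨h2, e2⟩ | ⟨h2, e2⟩ <;>
  rcases key (x - z) with ⟨h3, e3⟩ | ⟨h3, e3⟩ | ⟨h3, e3⟩ <;>
  first
  | (exfalso; omega)
  | (rw [e1, e2, e3]; split_ifs <;> first | (exfalso; omega) | norm_num)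

lemma cotlar (d : N → ℤ) (S : Matrix N N ℂ) :
    Hs d S * Hs d S = S * S + Hs d (S * Hs d S + Hs d S * S) - Z0 d S * Z0 d S := by
  ext a c
  simp only [Matrix.mul_apply, Matrix.add_apply, Matrix.sub_apply, Hs, Z0, of_apply]
  rw [← Finset.sum_add_distrib, Finset.mul_sum, ← Finset.sum_add_distrib, ← Finset.sum_sub_distrib]
  refine Finset.sum_congr rfl fun b _ => ?_
  have h := congrArg (fun t : ℤ => (t : ℂ)) (sgn_id (d a) (d b) (d c))
  push_cast at h
  have e : (if d a = d b then S a b else 0) * (if d b = d c then S b c else 0)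
      = (if d a = d b then (1 : ℂ) else 0) * (if d b = d c then 1 else 0) * (S a b * S b c) := by
    split_ifs <;> simp
  rw [e]
  have hI : Complex.I * Complex.I = -1 := Complex.I_mul_I
  linear_combination (S a b * S b c) * h +
    ((Int.sign (d a - d b) : ℂ) * (Int.sign (d b - d c) : ℂ)
      - (Int.sign (d a - d c) : ℂ) * ((Int.sign (d a - d b) : ℂ) +
      (Int.sign (d b - d c) : ℂ))) * (S a b * S b c) * hI

/-- boundedness of the Hilbert transform in Schatten `P`. -/
def HB (d : N → ℤ) (P c : ℝ) : Prop :=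
  ∀ (U V : Matrix N N ℂ) (l m : N → ℝ), IsU U → IsU V → Hs d (fc U l) = fc V m →
    lpn P m ≤ c * lpn P l

lemma lpn_two_sq {U : Matrix N N ℂ} (hU : IsU U) (l : N → ℝ) :
    ∑ a, |l a| ^ (2 : ℝ) = ∑ x, ∑ y, Complex.normSq (fc U l x y) := by
  have h1 : trace (fc U l * fc U l) = ((∑ a, l a * l a : ℝ) : ℂ) := by
    rw [fc_mul hU, trace_fc hU]
  have h2 : trace (fc U l * fc U l) = ((∑ x, ∑ y, Complex.normSq (fc U l x y) : ℝ) : ℂ) := by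
    rw [trace]
    push_cast
    refine Finset.sum_congr rfl fun x _ => ?_
    rw [diag_apply, Matrix.mul_apply]
    refine Finset.sum_congr rfl fun y _ => ?_
    rw [← (fc_herm U l).apply y x, ← Complex.mul_conj]; rfl
  rw [h1] at h2
  have h3 : ∑ a, l a * l a = ∑ x, ∑ y, Complex.normSq (fc U l x y) := by exact_mod_cast h2
  rw [← h3]
  refine Finset.sum_congr rfl fun a _ => ?_
  rw [Real.rpow_two, sq_abs, sq]

lemma HB_two (d : N → ℤ) : HB d 2 1 := by
  intro U V l m hU hV h
  rw [one_mul]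
  apply lpn_le_of (by norm_num)
  rw [lpn_two_sq hU l, lpn_two_sq hV m, ← h]
  refine Finset.sum_le_sum fun x _ => Finset.sum_le_sum fun y _ => ?_
  simp only [Hs, of_apply, map_mul, Complex.normSq_neg, Complex.normSq_I, one_mul]
  have : Complex.normSq ((Int.sign (d x - d y) : ℂ)) ≤ 1 := by
    rcases Int.sign_trichotomy (d x - d y) with h | h | h <;> simp [h]
  nlinarith [Complex.normSq_nonneg (fc U l x y)]

lemma sign_mul_rpow (w : ℝ) {r s : ℝ} (hr : 0 < r) (h : s + 1 = r) :
    w * ((SignType.sign w : ℝ) * |w| ^ s) = |w| ^ r := by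
  rcases eq_or_ne w 0 with h0 | h0
  · simp [h0, hr.ne', Real.zero_rpow]
  · rw [← mul_assoc, self_mul_sign, ← h, Real.rpow_add (abs_pos.2 h0), Real.rpow_one, mul_comm]

lemma abs_sign_le (w : ℝ) : |(SignType.sign w : ℝ)| ≤ 1 := by
  rcases SignType.sign w with _ | _ | _ <;> simp

/-- Hölder for the anticommutator. -/
lemma anticomm {U V Z : Matrix N N ℂ} {l m w : N → ℝ} (hU : IsU U) (hV : IsU V) (hZ : IsU Z)
    {P : ℝ} (hP : 2 ≤ P) (h : fc U l * fc V m + fc V m * fc U l = fc Z w) {r : ℝ} (hr : 0 < r) :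
    lpn P w ≤ r ^ 2 * lpn (2 * P) l ^ 2 + (r⁻¹) ^ 2 * lpn (2 * P) m ^ 2 := by
  set S := fc U l with hS
  set T := fc V m with hT
  set W := fc Z w with hW
  have hSh : S.IsHermitian := fc_herm U l
  have hTh : T.IsHermitian := fc_herm V m
  set v : N → ℝ := fun a => (SignType.sign (w a) : ℝ) * |w a| ^ (P - 1) with hv
  set av : N → ℝ := fun a => |w a| ^ (P - 1) with hav
  have hP0 : 0 < P := by linarith
  set q := P.conjExponent with hq
  have hpq : P.HolderConjugate q := Real.HolderConjugate.conjExponent (by linarith)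
  have e1 : lpn P w ^ P = (trace (W * fc Z v)).re := by
    rw [lpn_rpow hP0, hW, fc_mul hZ, trace_fc hZ, Complex.ofReal_re]
    refine Finset.sum_congr rfl fun a _ => ?_
    rw [hv, sign_mul_rpow _ hP0 (by ring)]
  set G : Matrix N N ℂ := ((r ^ 2 : ℝ) : ℂ) • (S * S) + (((r⁻¹) ^ 2 : ℝ) : ℂ) • (T * T) with hG
  have key : ∀ a, |((Zᴴ * W * Z) a a).re| ≤ ((Zᴴ * G * Z) a a).re := by
    intro a
    have hR1 : (((r : ℝ) : ℂ) • S - ((r⁻¹ : ℝ) : ℂ) • T).IsHermitian := by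
      unfold Matrix.IsHermitian
      rw [conjTranspose_sub, conjTranspose_smul, conjTranspose_smul, hSh.eq, hTh.eq]
      simp
    have hR2 : (((r : ℝ) : ℂ) • S + ((r⁻¹ : ℝ) : ℂ) • T).IsHermitian := by
      unfold Matrix.IsHermitian
      rw [conjTranspose_add, conjTranspose_smul, conjTranspose_smul, hSh.eq, hTh.eq]
      simp
    have hrr : ((r : ℝ) : ℂ) * ((r⁻¹ : ℝ) : ℂ) = 1 := by
      rw [← Complex.ofReal_mul, mul_inv_cancel₀ hr.ne']; simp
    have e1 : (((r : ℝ) : ℂ) • S - ((r⁻¹ : ℝ) : ℂ) • T) * (((r : ℝ) : ℂ) • S - ((r⁻¹ : ℝ) : ℂ) • T)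
        = G - W := by
      rw [hG, ← h]
      simp only [Matrix.sub_mul, Matrix.mul_sub, smul_sub, Matrix.smul_mul, Matrix.mul_smul, smul_smul,
        mul_comm ((r⁻¹ : ℝ) : ℂ) ((r : ℝ) : ℂ), hrr, one_smul]
      push_cast
      simp only [pow_two]
      abel
    have e2 : (((r : ℝ) : ℂ) • S + ((r⁻¹ : ℝ) : ℂ) • T) * (((r : ℝ) : ℂ) • S + ((r⁻¹ : ℝ) : ℂ) • T)
        = G + W := by
      rw [hG, ← h]
      simp only [Matrix.add_mul, Matrix.mul_add, smul_add, Matrix.smul_mul, Matrix.mul_smul, smul_smul,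
        mul_comm ((r⁻¹ : ℝ) : ℂ) ((r : ℝ) : ℂ), hrr, one_smul]
      push_cast
      simp only [pow_two]
      abel
    have i1 := sq_diag_nonneg hR1 Z a
    have i2 := sq_diag_nonneg hR2 Z a
    rw [e1, Matrix.mul_sub, Matrix.sub_mul, Matrix.sub_apply, Complex.sub_re] at i1
    rw [e2, Matrix.mul_add, Matrix.add_mul, Matrix.add_apply, Complex.add_re] at i2
    rw [abs_le]; constructor <;> linarith
  have e2 : (trace (W * fc Z v)).re ≤ (trace (G * fc Z av)).re := by
    rw [trace_mul_fc, trace_mul_fc, Complex.re_sum, Complex.re_sum]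
    refine Finset.sum_le_sum fun a _ => ?_
    rw [Complex.re_mul_ofReal, Complex.re_mul_ofReal]
    have hav0 : 0 ≤ av a := Real.rpow_nonneg (abs_nonneg _) _
    calc ((Zᴴ * W * Z) a a).re * v a ≤ |((Zᴴ * W * Z) a a).re * v a| := le_abs_self _
      _ = |((Zᴴ * W * Z) a a).re| * (|(SignType.sign (w a) : ℝ)| * av a) := by
          rw [abs_mul, hv]; simp only []; rw [abs_mul, abs_of_nonneg hav0]
      _ ≤ ((Zᴴ * G * Z) a a).re * (1 * av a) := by
          apply mul_le_mul (key a) _ (by positivity) ((abs_nonneg _).trans (key a))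
          exact mul_le_mul_of_nonneg_right (abs_sign_le _) hav0
      _ = _ := by rw [one_mul]
  have e3 : (trace (G * fc Z av)).re
      = r ^ 2 * (trace (S * S * fc Z av)).re + (r⁻¹) ^ 2 * (trace (T * T * fc Z av)).re := by
    rw [hG, Matrix.add_mul, Matrix.smul_mul, Matrix.smul_mul, trace_add, trace_smul, trace_smul,
      Complex.add_re, smul_eq_mul, smul_eq_mul, Complex.re_ofReal_mul, Complex.re_ofReal_mul]
  have hq0 : 0 < q := hpq.symm.pos
  have hqv : lpn q av = lpn P w ^ (P - 1) := by
    apply lpn_comp_rpow hq0 hP0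
    exact hpq.sub_one_mul_conj
  have sq_l : ∀ u : N → ℝ, lpn P (fun a => u a * u a) = lpn (2 * P) u ^ 2 := by
    intro u
    rw [← Real.rpow_two, ← lpn_comp_rpow hP0 (by linarith) rfl]
    congr 1; ext a; rw [Real.rpow_two, sq_abs, sq]
  have e4 : (trace (S * S * fc Z av)).re ≤ lpn (2 * P) l ^ 2 * lpn P w ^ (P - 1) := by
    rw [hS, fc_mul hU, ← hqv, ← sq_l]; exact holder hU hZ _ _ hpq
  have e5 : (trace (T * T * fc Z av)).re ≤ lpn (2 * P) m ^ 2 * lpn P w ^ (P - 1) := by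
    rw [hT, fc_mul hV, ← hqv, ← sq_l]; exact holder hV hZ _ _ hpq
  have e6 : lpn P w ^ P ≤ (r ^ 2 * lpn (2 * P) l ^ 2 + (r⁻¹) ^ 2 * lpn (2 * P) m ^ 2)
      * lpn P w ^ (P - 1) := by
    have r1 : 0 ≤ r ^ 2 := by positivity
    have r2 : 0 ≤ (r⁻¹) ^ 2 := by positivity
    calc _ = _ := e1
      _ ≤ _ := e2
      _ = _ := e3
      _ ≤ r ^ 2 * (lpn (2 * P) l ^ 2 * lpn P w ^ (P - 1))
          + (r⁻¹) ^ 2 * (lpn (2 * P) m ^ 2 * lpn P w ^ (P - 1)) :=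
          add_le_add (mul_le_mul_of_nonneg_left e4 r1) (mul_le_mul_of_nonneg_left e5 r2)
      _ = _ := by ring
  rcases (lpn_nonneg P w).eq_or_lt with h0 | h0
  · rw [← h0]; positivity
  · have : lpn P w ^ P = lpn P w * lpn P w ^ (P - 1) := by
      rw [← Real.rpow_one_add' h0.le (by linarith)]; congr 1; ring
    rw [this] at e6
    exact le_of_mul_le_mul_right e6 (Real.rpow_pos_of_pos h0 _)

lemma amgm_opt {x s t : ℝ} (hs : 0 ≤ s) (ht : 0 ≤ t)
    (h : ∀ r : ℝ, 0 < r → x ≤ r ^ 2 * s ^ 2 + (r⁻¹) ^ 2 * t ^ 2) : x ≤ 2 * s * t := by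
  have h' : ∀ ε : ℝ, 0 < ε → x ≤ 2 * (s + ε) * (t + ε) := by
    intro ε hε
    have hs' : 0 < s + ε := by linarith
    have ht' : 0 < t + ε := by linarith
    have := h (Real.sqrt ((t + ε) / (s + ε))) (Real.sqrt_pos.2 (by positivity))
    rw [inv_pow, Real.sq_sqrt (by positivity)] at this
    refine this.trans ?_
    have a1 : (t + ε) / (s + ε) * s ^ 2 ≤ (t + ε) / (s + ε) * (s + ε) ^ 2 := by
      apply mul_le_mul_of_nonneg_left _ (by positivity); nlinarith
    have a2 : ((t + ε) / (s + ε))⁻¹ * t ^ 2 ≤ ((t + ε) / (s + ε))⁻¹ * (t + ε) ^ 2 := by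
      apply mul_le_mul_of_nonneg_left _ (by positivity); nlinarith
    have a3 : (t + ε) / (s + ε) * (s + ε) ^ 2 = (s + ε) * (t + ε) := by field_simp
    have a4 : ((t + ε) / (s + ε))⁻¹ * (t + ε) ^ 2 = (s + ε) * (t + ε) := by field_simp
    linarith
  have hc : Filter.Tendsto (fun ε : ℝ => 2 * (s + ε) * (t + ε)) (nhdsWithin 0 (Set.Ioi 0))
      (nhds (2 * s * t)) := by
    have : Continuous (fun ε : ℝ => 2 * (s + ε) * (t + ε)) := by fun_prop
    have := this.tendsto 0
    simp only [add_zero] at this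
    exact this.mono_left nhdsWithin_le_nhds
  refine ge_of_tendsto hc ?_
  filter_upwards [self_mem_nhdsWithin] with ε hε using h' ε hε

lemma HB_double {d : N → ℤ} {P c : ℝ} (hP : 2 ≤ P) (hc : 0 ≤ c) (hB : HB d P c) :
    HB d (2 * P) (2 * c + 1) := by
  intro U V l m hU hV h
  obtain ⟨Z, hZ, w, hw⟩ := spectral (X := fc U l * fc V m + fc V m * fc U l) (by
    unfold Matrix.IsHermitian
    rw [conjTranspose_add, conjTranspose_mul, conjTranspose_mul, (fc_herm U l).eq,
      (fc_herm V m).eq, add_comm])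
  obtain ⟨Z', hZ', w', hw'⟩ := spectral (Hs_herm d (fc_herm Z w))
  obtain ⟨Y, hY, y0, hy0⟩ := spectral (Z0_herm d (fc_herm U l))
  have hw1 : lpn P w' ≤ c * lpn P w := hB Z Z' w w' hZ hZ' hw'
  have hw2 : lpn P w ≤ 2 * lpn (2 * P) l * lpn (2 * P) m :=
    amgm_opt (lpn_nonneg _ _) (lpn_nonneg _ _) fun r hr => anticomm hU hV hZ hP hw hr
  have hP0 : 0 < P := by linarith
  set q := P.conjExponent with hq
  have hpq : P.HolderConjugate q := Real.HolderConjugate.conjExponent (by linarith)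
  have hq0 : 0 < q := hpq.symm.pos
  set y : N → ℝ := fun a => |m a| ^ (2 * P - 2) with hy
  have hyn : lpn q y = lpn (2 * P) m ^ (2 * P - 2) := by
    apply lpn_comp_rpow hq0 (by linarith)
    have := hpq.sub_one_mul_conj
    linarith
  have e1 : lpn (2 * P) m ^ (2 * P) = (trace (fc V m * fc V m * fc V y)).re := by
    rw [lpn_rpow (by linarith), fc_mul hV, fc_mul hV, trace_fc hV, Complex.ofReal_re]
    refine Finset.sum_congr rfl fun a _ => ?_
    have : m a * m a = |m a| ^ (2 : ℝ) := by rw [Real.rpow_two, sq_abs, sq]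
    rw [this, hy]
    simp only []
    rw [← Real.rpow_add' (abs_nonneg _) (by linarith)]
    congr 1; ring
  have e2 : (trace (fc V m * fc V m * fc V y)).re
      = (trace (fc U l * fc U l * fc V y)).re + (trace (fc Z' w' * fc V y)).re
        - (trace (fc Y y0 * fc Y y0 * fc V y)).re := by
    have := cotlar d (fc U l)
    rw [h, hw, hw', hy0] at this
    rw [this, Matrix.sub_mul, Matrix.add_mul, trace_sub, trace_add, Complex.sub_re, Complex.add_re]
  have e3 : 0 ≤ (trace (fc Y y0 * fc Y y0 * fc V y)).re := by
    rw [fc_mul hY]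
    exact trace_fc_nonneg (fun a => mul_self_nonneg _) (fun a => Real.rpow_nonneg (abs_nonneg _) _)
  have e4 : (trace (fc U l * fc U l * fc V y)).re ≤ lpn (2 * P) l ^ 2 * lpn q y := by
    have : lpn (2 * P) l ^ 2 = lpn P (fun a => l a * l a) := by
      rw [← Real.rpow_two, ← lpn_comp_rpow hP0 (by linarith) rfl]
      congr 1; ext a; rw [Real.rpow_two, sq_abs, sq]
    rw [this, fc_mul hU]; exact holder hU hV _ _ hpq
  have e5 : (trace (fc Z' w' * fc V y)).re ≤ lpn P w' * lpn q y := holder hZ' hV _ _ hpq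
  set s := lpn (2 * P) l with hs
  set t := lpn (2 * P) m with ht
  have hs0 : 0 ≤ s := lpn_nonneg _ _
  have ht0 : 0 ≤ t := lpn_nonneg _ _
  have hw3 : lpn P w' ≤ c * (2 * s * t) := hw1.trans (mul_le_mul_of_nonneg_left hw2 hc)
  have hqy0 : 0 ≤ lpn q y := lpn_nonneg _ _
  have e6 : t ^ (2 * P) ≤ (s ^ 2 + c * (2 * s * t)) * lpn q y := by
    have := mul_le_mul_of_nonneg_right hw3 hqy0
    linarith
  rcases ht0.eq_or_lt with h0 | h0
  · rw [← h0]; positivity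
  have e7 : t ^ (2 * P) = t ^ 2 * lpn q y := by
    rw [hyn, ← Real.rpow_two, ← Real.rpow_add h0]; congr 1; ring
  rw [e7] at e6
  have e8 : t ^ 2 ≤ s ^ 2 + c * (2 * s * t) :=
    le_of_mul_le_mul_right e6 (by rw [hyn]; exact Real.rpow_pos_of_pos h0 _)
  by_contra hcon
  push Not at hcon
  have k1 : s ≤ t := by nlinarith
  nlinarith [mul_nonneg hc hs0]

lemma HB_dyadic (d : N → ℤ) (k : ℕ) : HB d (2 ^ (k + 1)) (2 ^ (k + 1) - 1) := by
  induction k with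
  | zero => have := HB_two d; norm_num; exact this
  | succ k ih =>
    have h2 : (2 : ℝ) ≤ 2 ^ (k + 1) := by
      rw [pow_succ]; nlinarith [one_le_pow₀ (n := k) (by norm_num : (1 : ℝ) ≤ 2)]
    have := HB_double h2 (by linarith) ih
    convert this using 1 <;> ring

end EPR
end

open scoped BigOperators
open Finset

noncomputable section
set_option linter.unusedSectionVars false
set_option linter.unusedSimpArgs false

namespace EPR

variable {I J : Type*} [Fintype I] [Fintype J]

lemma lpn_mono {r : ℝ} (hr : 0 < r) {u v : I → ℝ} (h : ∀ a, |u a| ≤ |v a|) :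
    lpn r u ≤ lpn r v :=
  lpn_le_of hr _ _ (Finset.sum_le_sum fun a _ => Real.rpow_le_rpow (abs_nonneg _) (h a) hr.le)

lemma bil_bound (L : J → I → ℝ) {M r q : ℝ} (hM : 0 ≤ M) (hr : r.HolderConjugate q)
    (h : ∀ u : I → ℝ, lpn r (fun x => ∑ a, L x a * u a) ≤ M * lpn r u) (u : I → ℂ) (v : J → ℂ) :
    ‖∑ x, ∑ a, (L x a : ℂ) * u a * v x‖
      ≤ 2 * M * lpn r (fun a => ‖u a‖) * lpn q (fun x => ‖v x‖) := by
  have hr0 := hr.pos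
  have key : ∀ w : I → ℝ, (∀ a, |w a| ≤ ‖u a‖) →
      ∑ x, |∑ a, L x a * w a| * ‖v x‖ ≤ M * lpn r (fun a => ‖u a‖) * lpn q (fun x => ‖v x‖) := by
    intro w hw
    refine (Real.inner_le_Lp_mul_Lq univ _ _ hr).trans ?_
    refine mul_le_mul_of_nonneg_right ?_ (lpn_nonneg _ _)
    simp only [abs_abs]
    refine (h w).trans (mul_le_mul_of_nonneg_left (lpn_mono hr0 fun a => ?_) hM)
    rw [abs_of_nonneg (norm_nonneg (u a))]; exact hw a
  have h1 := key (fun a => (u a).re) (fun a => Complex.abs_re_le_norm _)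
  have h2 := key (fun a => (u a).im) (fun a => Complex.abs_im_le_norm _)
  calc ‖∑ x, ∑ a, (L x a : ℂ) * u a * v x‖
      ≤ ∑ x, ‖∑ a, (L x a : ℂ) * u a * v x‖ := norm_sum_le _ _
    _ ≤ ∑ x, (|∑ a, L x a * (u a).re| * ‖v x‖ + |∑ a, L x a * (u a).im| * ‖v x‖) := by
        refine Finset.sum_le_sum fun x _ => ?_
        rw [← Finset.sum_mul, norm_mul, ← add_mul]
        refine mul_le_mul_of_nonneg_right ?_ (norm_nonneg _)
        refine (Complex.norm_le_abs_re_add_abs_im _).trans (le_of_eq ?_)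
        simp [Complex.re_sum, Complex.im_sum]
    _ ≤ _ := by rw [Finset.sum_add_distrib]; linarith

lemma norm_sgn_exp (x : ℝ) (w : ℂ) (hw : w.re ≠ 0) :
    ‖((SignType.sign x : ℝ) : ℂ) * Complex.exp (w * (Real.log |x| : ℝ))‖ = |x| ^ w.re := by
  rw [norm_mul, Complex.norm_exp, Complex.re_mul_ofReal, Complex.norm_real, Real.norm_eq_abs]
  rcases eq_or_ne x 0 with h | h
  · simp [h, Real.zero_rpow hw]
  · rw [Real.rpow_def_of_pos (abs_pos.2 h), mul_comm w.re]
    have : |(SignType.sign x : ℝ)| = 1 := by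
      rcases lt_or_gt_of_ne h with h | h
      · simp [sign_neg h]
      · simp [sign_pos h]
    rw [this, one_mul]

lemma lpn_one_of {r : ℝ} {u v : I → ℝ} {p : ℝ} (hu : ∑ a, |u a| ^ p = 1)
    (h : ∀ a, v a = |u a| ^ (p / r)) (hr : 0 < r) : lpn r v = 1 := by
  unfold lpn
  have : ∑ a, |v a| ^ r = 1 := by
    rw [← hu]
    refine Finset.sum_congr rfl fun a _ => ?_
    rw [h a, abs_of_nonneg (Real.rpow_nonneg (abs_nonneg _) _), ← Real.rpow_mul (abs_nonneg _),
      div_mul_cancel₀ _ hr.ne']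
  rw [this, Real.one_rpow]

lemma RT_norm (L : J → I → ℝ) {M P p : ℝ} (hM : 0 < M) (hP : 2 < P) (hp2 : 2 ≤ p) (hpP : p ≤ P)
    (h2 : ∀ u : I → ℝ, lpn 2 (fun x => ∑ a, L x a * u a) ≤ M * lpn 2 u)
    (hPb : ∀ u : I → ℝ, lpn P (fun x => ∑ a, L x a * u a) ≤ M * lpn P u)
    {q : ℝ} (hpq : p.HolderConjugate q)
    (u : I → ℝ) (g : J → ℝ) (hu : ∑ a, |u a| ^ p = 1) (hg : ∑ x, |g x| ^ q = 1) :
    ‖∑ x, ∑ a, (L x a : ℂ) * (u a : ℂ) * (g x : ℂ)‖ ≤ 2 * M := by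
  have hp0 : 0 < p := by linarith
  have hq0 : 0 < q := hpq.symm.pos
  have hP0 : 0 < P := by linarith
  set ell : ℂ → ℂ := fun z => (1 - z) / 2 + z / (P : ℂ) with hell
  set F : ℂ → ℂ := fun z => ∑ x, ∑ a, (L x a : ℂ) *
    (((SignType.sign (u a) : ℝ) : ℂ) * Complex.exp ((p * ell z) * (Real.log |u a| : ℝ))) *
    (((SignType.sign (g x) : ℝ) : ℂ) * Complex.exp ((q * (1 - ell z)) * (Real.log |g x| : ℝ))) with hF
  have ell_re : ∀ z, (ell z).re = (1 - z.re) / 2 + z.re / P := by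
    intro z
    simp only [hell, Complex.add_re]
    congr 1
    · have : (1 - z) / 2 = (1 - z) / ((2 : ℝ) : ℂ) := by norm_num
      rw [this, Complex.div_ofReal_re]; simp
    · rw [Complex.div_ofReal_re]
  have reA : ∀ z, ((p : ℂ) * ell z).re = p * ((1 - z.re) / 2 + z.re / P) := by
    intro z; rw [Complex.re_ofReal_mul, ell_re]
  have reB : ∀ z, ((q : ℂ) * (1 - ell z)).re = q * (1 - ((1 - z.re) / 2 + z.re / P)) := by
    intro z; rw [Complex.re_ofReal_mul, Complex.sub_re, ell_re]; simp
  -- edge bound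
  have edge : ∀ z : ℂ, ∀ r r' : ℝ, r.HolderConjugate r' →
      (1 - z.re) / 2 + z.re / P = 1 / r →
      (∀ u : I → ℝ, lpn r (fun x => ∑ a, L x a * u a) ≤ M * lpn r u) → ‖F z‖ ≤ 2 * M := by
    intro z r r' hrr hz hb
    have hr0 := hrr.pos
    have hr'0 := hrr.symm.pos
    have hb1 := bil_bound L hM.le hrr hb
      (fun a => ((SignType.sign (u a) : ℝ) : ℂ) * Complex.exp ((p * ell z) * (Real.log |u a| : ℝ)))
      (fun x => ((SignType.sign (g x) : ℝ) : ℂ)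
        * Complex.exp ((q * (1 - ell z)) * (Real.log |g x| : ℝ)))
    have eA : ((p : ℂ) * ell z).re = p / r := by rw [reA, hz]; ring
    have eB : ((q : ℂ) * (1 - ell z)).re = q / r' := by
      rw [reB, hz, one_div, hrr.one_sub_inv]; ring
    rw [lpn_one_of hu (fun a => by rw [norm_sgn_exp _ _ (by rw [eA]; positivity), eA]) hr0,
      lpn_one_of hg (fun a => by rw [norm_sgn_exp _ _ (by rw [eB]; positivity), eB]) hr'0] at hb1
    rw [mul_one, mul_one] at hb1; exact hb1
  have hFd : Differentiable ℂ F := by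
    simp only [hF, hell]; fun_prop
  have hPhalf : 1 / P < 1 / 2 := one_div_lt_one_div_of_lt (by norm_num) hP
  have hP1 : 0 < 1 / P := by positivity
  have hbdd : BddAbove ((norm ∘ F) '' Complex.HadamardThreeLines.verticalClosedStrip 0 1) := by
    refine ⟨∑ x, ∑ a, |L x a| * (1 * Real.exp (p * |Real.log (|u a|)|)) *
      (1 * Real.exp (q * |Real.log (|g x|)|)), ?_⟩
    rintro _ ⟨z, hz, rfl⟩
    have hz' : 0 ≤ z.re ∧ z.re ≤ 1 := hz
    have l0 : 0 ≤ (1 - z.re) / 2 + z.re / P :=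
      add_nonneg (by linarith [hz'.2]) (div_nonneg hz'.1 hP0.le)
    have l1 : (1 - z.re) / 2 + z.re / P ≤ 1 := by
      have : z.re / P ≤ z.re / 2 := by
        rw [div_eq_mul_one_div, div_eq_mul_one_div z.re 2]
        exact mul_le_mul_of_nonneg_left hPhalf.le hz'.1
      linarith
    have expb : ∀ c t y : ℝ, 0 ≤ c → 0 ≤ t → t ≤ 1 → c * t * y ≤ c * |y| := by
      intro c t y hc ht ht1
      calc c * t * y ≤ c * t * |y| := mul_le_mul_of_nonneg_left (le_abs_self _) (by positivity)
        _ ≤ c * 1 * |y| := by gcongr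
        _ = _ := by ring
    simp only [Function.comp, hF]
    refine (norm_sum_le _ _).trans (Finset.sum_le_sum fun x _ => ?_)
    refine (norm_sum_le _ _).trans (Finset.sum_le_sum fun a _ => ?_)
    rw [norm_mul, norm_mul, norm_mul, norm_mul, Complex.norm_real, Complex.norm_real,
      Complex.norm_real, Complex.norm_exp, Complex.norm_exp, Complex.re_mul_ofReal,
      Complex.re_mul_ofReal, reA, reB, Real.norm_eq_abs, Real.norm_eq_abs, Real.norm_eq_abs]
    refine mul_le_mul (mul_le_mul_of_nonneg_left (mul_le_mul (abs_sign_le _)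
      (Real.exp_le_exp.2 (expb _ _ _ hp0.le l0 l1)) (Real.exp_pos _).le zero_le_one)
      (abs_nonneg _)) (mul_le_mul (abs_sign_le _)
      (Real.exp_le_exp.2 (expb _ _ _ hq0.le (by linarith) (by linarith)))
      (Real.exp_pos _).le zero_le_one) (by positivity) (by positivity)
  set τ : ℝ := (1 / 2 - 1 / p) / (1 / 2 - 1 / P) with hτ
  have hpP' : 1 / P ≤ 1 / p := one_div_le_one_div_of_le hp0 hpP
  have hp2' : 1 / p ≤ 1 / 2 := one_div_le_one_div_of_le (by norm_num) hp2
  have hden : 0 < 1 / 2 - 1 / P := by linarith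
  have hτ0 : 0 ≤ τ := div_nonneg (by linarith) hden.le
  have hτ1 : τ ≤ 1 := by rw [hτ, div_le_one hden]; linarith
  have hτe : (1 - τ) / 2 + τ / P = 1 / p := by
    have : τ * (1 / 2 - 1 / P) = 1 / 2 - 1 / p := by rw [hτ, div_mul_cancel₀ _ hden.ne']
    rw [div_eq_mul_one_div τ P]; linarith
  have main := Complex.HadamardThreeLines.norm_le_interp_of_mem_verticalClosedStrip₀₁' F
    (z := (τ : ℂ)) (a := 2 * M) (b := 2 * M) (by
      change (τ : ℂ).re ∈ Set.Icc (0 : ℝ) 1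
      rw [Complex.ofReal_re]; exact ⟨hτ0, hτ1⟩) hFd.diffContOnCl hbdd
    (by
      intro z hz
      have hz' : z.re = 0 := hz
      exact edge z 2 2 Real.HolderConjugate.two_two (by rw [hz']; norm_num) h2)
    (by
      intro z hz
      have hz' : z.re = 1 := hz
      exact edge z P _ (Real.HolderConjugate.conjExponent (by linarith)) (by rw [hz']; norm_num) hPb)
  rw [Complex.ofReal_re, ← Real.rpow_add (by linarith)] at main
  have e1 : 1 - τ + τ = 1 := by ring
  rw [e1, Real.rpow_one] at main
  have hval : F τ = ∑ x, ∑ a, (L x a : ℂ) * (u a : ℂ) * (g x : ℂ) := by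
    have ellτ : ell τ = ((1 / p : ℝ) : ℂ) := by
      rw [← hτe]; simp only [hell]; push_cast; rfl
    have sg : ∀ t : ℝ, (SignType.sign t : ℝ) * Real.exp (Real.log |t|) = t := by
      intro t
      rcases eq_or_ne t 0 with h | h
      · simp [h]
      · rw [Real.exp_log (abs_pos.2 h), sign_mul_abs]
    simp only [hF, ellτ]
    refine Finset.sum_congr rfl fun x _ => Finset.sum_congr rfl fun a _ => ?_
    have c1 : (p : ℂ) * ((1 / p : ℝ) : ℂ) = 1 := by
      rw [← Complex.ofReal_mul, mul_one_div_cancel hp0.ne', Complex.ofReal_one]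
    have c2 : (q : ℂ) * (1 - ((1 / p : ℝ) : ℂ)) = 1 := by
      have : q * (1 - 1 / p) = 1 := by
        rw [one_div, hpq.one_sub_inv, mul_inv_cancel₀ hq0.ne']
      exact_mod_cast this
    have sg2 : ∀ t : ℝ, ((SignType.sign t : ℝ) : ℂ) * Complex.exp ((Real.log |t| : ℝ) : ℂ) = t := by
      intro t
      rw [← Complex.ofReal_exp, ← Complex.ofReal_mul, sg]
    rw [c1, c2, one_mul, one_mul, sg2, sg2]
  rw [hval] at main
  exact main

lemma lpn_smul {p : ℝ} (hp : 0 < p) (c : ℝ) (u : I → ℝ) :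
    lpn p (fun a => c * u a) = |c| * lpn p u := by
  unfold lpn
  have : ∑ a, |c * u a| ^ p = |c| ^ p * ∑ a, |u a| ^ p := by
    rw [Finset.mul_sum]
    refine Finset.sum_congr rfl fun a _ => ?_
    rw [abs_mul, Real.mul_rpow (abs_nonneg _) (abs_nonneg _)]
  rw [this, Real.mul_rpow (Real.rpow_nonneg (abs_nonneg _) _)
    (Finset.sum_nonneg fun _ _ => Real.rpow_nonneg (abs_nonneg _) _), ← Real.rpow_mul (abs_nonneg _),
    mul_one_div_cancel hp.ne', Real.rpow_one]

/-- duality: existence of a norming functional. -/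
lemma exists_dual {p q : ℝ} (hpq : p.HolderConjugate q) (w : J → ℝ) (hw : 0 < lpn p w) :
    ∃ g : J → ℝ, ∑ x, |g x| ^ q = 1 ∧ ∑ x, w x * g x = lpn p w := by
  have hp0 := hpq.pos
  have hq0 := hpq.symm.pos
  set n := lpn p w with hn
  have e : n ^ p = ∑ a, |w a| ^ p := lpn_rpow hp0 w
  refine ⟨fun x => (SignType.sign (w x) : ℝ) * |w x| ^ (p - 1) * (n ^ (p - 1))⁻¹, ?_, ?_⟩
  · have : ∀ x, |(SignType.sign (w x) : ℝ) * |w x| ^ (p - 1) * (n ^ (p - 1))⁻¹| ^ q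
        = |w x| ^ p * (n ^ p)⁻¹ := by
      intro x
      have hpos : 0 ≤ n ^ (p - 1) := Real.rpow_nonneg hw.le _
      have a1 : |(SignType.sign (w x) : ℝ) * |w x| ^ (p - 1)| = |w x| ^ (p - 1) := by
        rcases eq_or_ne (w x) 0 with h | h
        · rw [h]; simp [Real.zero_rpow (sub_ne_zero.2 hpq.lt.ne')]
        · rw [abs_mul, abs_of_nonneg (Real.rpow_nonneg (abs_nonneg (w x)) _)]
          have : |(SignType.sign (w x) : ℝ)| = 1 := by
            rcases lt_or_gt_of_ne h with h | h
            · simp [sign_neg h]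
            · simp [sign_pos h]
          rw [this, one_mul]
      rw [abs_mul, a1, abs_of_nonneg (inv_nonneg.2 hpos),
        Real.mul_rpow (Real.rpow_nonneg (abs_nonneg _) _) (inv_nonneg.2 hpos),
        Real.inv_rpow hpos, ← Real.rpow_mul (abs_nonneg _), ← Real.rpow_mul hw.le,
        hpq.sub_one_mul_conj]
    simp only [this]
    rw [← Finset.sum_mul, ← e, mul_inv_cancel₀ (Real.rpow_pos_of_pos hw _).ne']
  · have : ∀ x, w x * ((SignType.sign (w x) : ℝ) * |w x| ^ (p - 1) * (n ^ (p - 1))⁻¹)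
        = |w x| ^ p * (n ^ (p - 1))⁻¹ := by
      intro x
      rw [← mul_assoc, sign_mul_rpow _ hp0 (by ring)]
    simp only [this]
    rw [← Finset.sum_mul, ← e]
    have : n ^ p = n * n ^ (p - 1) := by
      rw [← Real.rpow_one_add' hw.le (by linarith)]; congr 1; ring
    rw [this, mul_assoc, mul_inv_cancel₀ (Real.rpow_pos_of_pos hw _).ne', mul_one]

lemma RT (L : J → I → ℝ) {M P p : ℝ} (hM : 0 < M) (hP : 2 < P) (hp2 : 2 ≤ p) (hpP : p ≤ P)
    (h2 : ∀ u : I → ℝ, lpn 2 (fun x => ∑ a, L x a * u a) ≤ M * lpn 2 u)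
    (hPb : ∀ u : I → ℝ, lpn P (fun x => ∑ a, L x a * u a) ≤ M * lpn P u) (u : I → ℝ) :
    lpn p (fun x => ∑ a, L x a * u a) ≤ 2 * M * lpn p u := by
  have hp0 : 0 < p := by linarith
  have hpq : p.HolderConjugate p.conjExponent := Real.HolderConjugate.conjExponent (by linarith)
  rcases (lpn_nonneg p u).eq_or_lt with h0 | h0
  · have hz : ∀ a, u a = 0 := by
      intro a
      have := lpn_rpow hp0 u
      rw [← h0, Real.zero_rpow hp0.ne'] at this
      have := (Finset.sum_eq_zero_iff_of_nonneg
        (fun a _ => Real.rpow_nonneg (abs_nonneg (u a)) p)).1 this.symm a (mem_univ a)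
      rw [Real.rpow_eq_zero (abs_nonneg _) hp0.ne', abs_eq_zero] at this
      exact this
    rw [← h0]
    simp only [hz, mul_zero, Finset.sum_const_zero]
    unfold lpn
    simp [Real.zero_rpow hp0.ne', hp0.ne']
  · set w : J → ℝ := fun x => ∑ a, L x a * u a with hw
    rcases (lpn_nonneg p w).eq_or_lt with h1 | h1
    · rw [← h1]; positivity
    obtain ⟨g, hg1, hg2⟩ := exists_dual hpq w h1
    set n := lpn p u
    have hu1 : ∑ a, |n⁻¹ * u a| ^ p = 1 := by
      rw [← lpn_rpow hp0 (fun a => n⁻¹ * u a), lpn_smul hp0, abs_of_pos (inv_pos.2 h0),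
        inv_mul_cancel₀ h0.ne', Real.one_rpow]
    have := RT_norm L hM hP hp2 hpP h2 hPb hpq _ g hu1 hg1
    have e : (∑ x, ∑ a, (L x a : ℂ) * ((n⁻¹ * u a : ℝ) : ℂ) * (g x : ℂ))
        = ((n⁻¹ * lpn p w : ℝ) : ℂ) := by
      rw [← hg2, Finset.mul_sum]
      push_cast
      refine Finset.sum_congr rfl fun x _ => ?_
      rw [hw]
      push_cast
      rw [Finset.sum_mul, Finset.mul_sum]
      refine Finset.sum_congr rfl fun a _ => ?_
      ring
    rw [e, Complex.norm_real, Real.norm_eq_abs, abs_of_nonneg (by positivity)] at this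
    rw [inv_mul_le_iff₀ h0] at this
    linarith

end EPR
end

open scoped BigOperators
open Finset

noncomputable section
set_option linter.unusedSectionVars false
set_option linter.unusedSimpArgs false

namespace EPR

open Matrix

variable {N : Type*} [Fintype N] [DecidableEq N]

lemma lpn_HB {d : N → ℤ} {P c : ℝ} (hP : 1 ≤ P) (hB : HB d P c) {U W : Matrix N N ℂ}
    (hU : IsU U) (hW : IsU W) (l : N → ℝ) :
    lpn P (fun x => ((W * Hs d (fc U l) * Wᴴ) x x).re) ≤ c * lpn P l := by
  obtain ⟨V, hV, m, hm⟩ := spectral (Hs_herm d (fc_herm U l))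
  have h1 := hB U V l m hU hV hm
  rw [hm, fc_conj]
  exact (diag_le (hW.mul hV) m hP).trans h1

lemma fc_lin (d : N → ℤ) (U W : Matrix N N ℂ) (l : N → ℝ) (x : N) :
    ∑ a, ((W * Hs d (Matrix.of fun x y => U x a * star (U y a)) * Wᴴ) x x).re * l a
      = ((W * Hs d (fc U l) * Wᴴ) x x).re := by
  have h1 : Hs d (fc U l) = ∑ a, (l a : ℂ) • Hs d (Matrix.of fun x y => U x a * star (U y a)) := by
    ext y z
    simp only [Hs, of_apply, fc_apply, Matrix.sum_apply, Matrix.smul_apply, smul_eq_mul,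
      Finset.mul_sum]
    refine Finset.sum_congr rfl fun a _ => ?_
    ring
  rw [h1, Matrix.mul_sum, Matrix.sum_mul, Matrix.sum_apply, Complex.re_sum]
  refine Finset.sum_congr rfl fun a _ => ?_
  rw [Matrix.mul_smul, Matrix.smul_mul, Matrix.smul_apply, smul_eq_mul, Complex.re_ofReal_mul,
    mul_comm]

/-- triangular truncation on the diagonal. -/
lemma hilbert_diag (d : N → ℤ) {U W : Matrix N N ℂ} (hU : IsU U) (hW : IsU W) {p : ℝ} (hp : 2 ≤ p)
    (l : N → ℝ) :
    lpn p (fun x => ((W * Hs d (fc U l) * Wᴴ) x x).re) ≤ 4 * p * lpn p l := by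
  obtain ⟨k, hk1, hk2⟩ := exists_nat_pow_near (x := p) (y := (2 : ℝ)) (by linarith) (by norm_num)
  have hk : k ≠ 0 := by rintro rfl; norm_num at hk2; linarith
  obtain ⟨k, rfl⟩ : ∃ j, k = j + 1 := ⟨k - 1, by omega⟩
  have hP : (2 : ℝ) < 2 ^ (k + 1 + 1) := by linarith
  have hPp : (2 : ℝ) ^ (k + 1 + 1) ≤ 2 * p := by rw [pow_succ]; linarith
  have h := RT (fun x a => ((W * Hs d (Matrix.of fun x y => U x a * star (U y a)) * Wᴴ) x x).re)
    (M := 2 ^ (k + 1 + 1)) (P := 2 ^ (k + 1 + 1)) (p := p) (by linarith) hP hp hk2.le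
    (by
      intro u
      simp only [fc_lin]
      refine (lpn_HB (by norm_num) (HB_two d) hU hW u).trans ?_
      exact mul_le_mul_of_nonneg_right (by linarith) (lpn_nonneg _ _))
    (by
      intro u
      simp only [fc_lin]
      refine (lpn_HB (by linarith) (HB_dyadic d _) hU hW u).trans ?_
      exact mul_le_mul_of_nonneg_right (by linarith) (lpn_nonneg _ _)) l
  simp only [fc_lin] at h
  refine h.trans (mul_le_mul_of_nonneg_right (by linarith) (lpn_nonneg _ _))

end EPR
end

open scoped BigOperators
open Finset

noncomputable section
set_option linter.unusedSectionVars false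
set_option linter.unusedSimpArgs false

namespace EPR

open Matrix

variable {N : Type*} [Fintype N] [DecidableEq N]

/-- odd power -/
def oddpow (r t : ℝ) : ℝ := (SignType.sign t : ℝ) * |t| ^ r

lemma oddpow_nonneg {r t : ℝ} (hr : 0 < r) (ht : 0 ≤ t) : oddpow r t = t ^ r := by
  unfold oddpow
  rcases ht.eq_or_lt with h | h
  · rw [← h]; simp [Real.zero_rpow hr.ne']
  · rw [sign_pos h, abs_of_pos h]; simp

lemma oddpow_neg (r t : ℝ) : oddpow r (-t) = - oddpow r t := by
  unfold oddpow
  rw [Left.sign_neg, abs_neg]; simp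

lemma tangent {r x y : ℝ} (hr : 1 ≤ r) (hy : 0 ≤ y) (hxy : y ≤ x) :
    x ^ r - y ^ r ≤ r * x ^ (r - 1) * (x - y) := by
  rcases (hy.trans hxy).eq_or_lt with h | h
  · have : y = x := by linarith
    rw [this]; simp
  · have hb := one_add_mul_self_le_rpow_one_add (s := y / x - 1) (by
      have := div_nonneg hy h.le; linarith) hr
    rw [add_sub_cancel, Real.div_rpow hy h.le, le_div_iff₀ (Real.rpow_pos_of_pos h _)] at hb
    have hx : x ^ r = x * x ^ (r - 1) := by
      rw [← Real.rpow_one_add' h.le (by linarith)]; congr 1; ring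
    have : (1 + r * (y / x - 1)) * x ^ r = x ^ r + r * x ^ (r - 1) * (y - x) := by
      rw [hx]; field_simp
    rw [this] at hb
    linarith

lemma dd_pos {r x y : ℝ} (hr : 1 ≤ r) (hx : 0 ≤ x) (hy : 0 ≤ y) :
    (x ^ r - y ^ r) * (x - y) ≤ r * (x ^ (r - 1) + y ^ (r - 1)) * (x - y) ^ 2 := by
  have hX := Real.rpow_nonneg hx (r - 1)
  have hY := Real.rpow_nonneg hy (r - 1)
  have hr0 : 0 ≤ r := by linarith
  rcases le_total y x with h | h
  · have := mul_le_mul_of_nonneg_right (tangent hr hy h) (sub_nonneg.2 h)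
    have h2 : 0 ≤ r * y ^ (r - 1) * (x - y) ^ 2 := by positivity
    nlinarith
  · have := mul_le_mul_of_nonneg_right (tangent hr hx h) (sub_nonneg.2 h)
    have h2 : 0 ≤ r * x ^ (r - 1) * (x - y) ^ 2 := by positivity
    nlinarith

lemma dd_mixed {r x y : ℝ} (hr : 1 ≤ r) (hx : 0 ≤ x) (hy : 0 ≤ y) :
    (x ^ r + y ^ r) * (x + y) ≤ r * (x ^ (r - 1) + y ^ (r - 1)) * (x + y) ^ 2 := by
  have hX := Real.rpow_nonneg hx (r - 1)
  have hY := Real.rpow_nonneg hy (r - 1)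
  have ex : ∀ z : ℝ, 0 ≤ z → z ^ r = z * z ^ (r - 1) := by
    intro z hz
    rw [← Real.rpow_one_add' hz (by linarith)]; congr 1; ring
  rw [ex x hx, ex y hy]
  have h1 : x * x ^ (r - 1) + y * y ^ (r - 1) ≤ (x ^ (r - 1) + y ^ (r - 1)) * (x + y) := by
    nlinarith [mul_nonneg hx hY, mul_nonneg hy hX]
  have h2 : (x ^ (r - 1) + y ^ (r - 1)) * (x + y) ≤ r * ((x ^ (r - 1) + y ^ (r - 1)) * (x + y)) :=
    le_mul_of_one_le_left (by positivity) hr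
  have := mul_le_mul_of_nonneg_right (h1.trans h2) (add_nonneg hx hy)
  linarith

lemma dd_le {r : ℝ} (hr : 1 ≤ r) (a b : ℝ) :
    (oddpow r a - oddpow r b) * (a - b) ≤ r * (|a| ^ (r - 1) + |b| ^ (r - 1)) * (a - b) ^ 2 := by
  have hr0 : 0 < r := by linarith
  rcases le_total 0 a with ha | ha <;> rcases le_total 0 b with hb | hb
  · rw [oddpow_nonneg hr0 ha, oddpow_nonneg hr0 hb, abs_of_nonneg ha, abs_of_nonneg hb]
    exact dd_pos hr ha hb
  · have e : oddpow r b = - (-b) ^ r := by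
      rw [← oddpow_nonneg hr0 (by linarith : 0 ≤ -b), oddpow_neg]; ring
    rw [oddpow_nonneg hr0 ha, e, abs_of_nonneg ha, abs_of_nonpos hb]
    have := dd_mixed hr ha (by linarith : 0 ≤ -b)
    simp only [sub_neg_eq_add, ← sub_eq_add_neg] at this ⊢
    linarith
  · have e : oddpow r a = - (-a) ^ r := by
      rw [← oddpow_nonneg hr0 (by linarith : 0 ≤ -a), oddpow_neg]; ring
    rw [oddpow_nonneg hr0 hb, e, abs_of_nonneg hb, abs_of_nonpos ha]
    have := dd_mixed hr hb (by linarith : 0 ≤ -a)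
    nlinarith
  · have e : oddpow r b = - (-b) ^ r := by
      rw [← oddpow_nonneg hr0 (by linarith : 0 ≤ -b), oddpow_neg]; ring
    have e' : oddpow r a = - (-a) ^ r := by
      rw [← oddpow_nonneg hr0 (by linarith : 0 ≤ -a), oddpow_neg]; ring
    rw [e, e', abs_of_nonpos ha, abs_of_nonpos hb]
    have := dd_pos hr (by linarith : 0 ≤ -a) (by linarith : 0 ≤ -b)
    nlinarith

/-- double operator integral formula for trace. -/
lemma trace_AfX {A U V : Matrix N N ℂ} (hA : A.IsHermitian) (_hU : IsU U) (hV : IsU V) (y : N → ℝ) :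
    trace (A * A * fc U y) =
      ((∑ a, ∑ b, Complex.normSq ((Uᴴ * A * V) a b) * y a : ℝ) : ℂ) := by
  rw [trace_mul_fc]
  push_cast
  refine Finset.sum_congr rfl fun a _ => ?_
  rw [← Finset.sum_mul]
  congr 1
  have : Uᴴ * (A * A) * U = (Uᴴ * A * V) * (Uᴴ * A * V)ᴴ := by
    rw [conjTranspose_mul, conjTranspose_mul, conjTranspose_conjTranspose, hA.eq]
    have : Uᴴ * A * V * (Vᴴ * (A * U)) = Uᴴ * A * (V * Vᴴ) * (A * U) := by
      simp only [Matrix.mul_assoc]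
    rw [this, hV.2]
    simp only [Matrix.mul_assoc, Matrix.mul_one, Matrix.one_mul]
  rw [this, Matrix.mul_apply]
  refine Finset.sum_congr rfl fun b _ => ?_
  rw [conjTranspose_apply, RCLike.star_def, Complex.mul_conj]

lemma trace_AfY {A U V : Matrix N N ℂ} (hA : A.IsHermitian) (hU : IsU U) (hV : IsU V) (y : N → ℝ) :
    trace (A * A * fc V y) =
      ((∑ a, ∑ b, Complex.normSq ((Uᴴ * A * V) a b) * y b : ℝ) : ℂ) := by
  rw [trace_AfX hA hV hU, Finset.sum_comm]
  congr 1
  refine Finset.sum_congr rfl fun a _ => Finset.sum_congr rfl fun b _ => ?_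
  congr 1
  have : (Vᴴ * A * U) = (Uᴴ * A * V)ᴴ := by
    rw [conjTranspose_mul, conjTranspose_mul, conjTranspose_conjTranspose, hA.eq, Matrix.mul_assoc]
  rw [this, conjTranspose_apply, RCLike.star_def, Complex.normSq_conj]

lemma trace_doi {A U V : Matrix N N ℂ} (hA : A.IsHermitian) (hU : IsU U) (hV : IsU V)
    {l m : N → ℝ} (h : fc U l - fc V m = (2 : ℂ) • A) {r : ℝ} (hr : 1 ≤ r) :
    (trace (A * (fc U (fun a => oddpow r (l a)) - fc V (fun a => oddpow r (m a))))).re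
      ≤ 2 * r * ((trace (A * A * fc U (fun a => |l a| ^ (r - 1)))).re
        + (trace (A * A * fc V (fun a => |m a| ^ (r - 1)))).re) := by
  set B := Uᴴ * A * V with hB
  set G := Uᴴ * V with hG
  have cnj : ∀ (y z : N → ℝ), Uᴴ * (fc U y - fc V z) * V
      = diagonal (fun a => (y a : ℂ)) * G - G * diagonal (fun a => (z a : ℂ)) := by
    intro y z
    rw [Matrix.mul_sub, Matrix.sub_mul]
    congr 1
    · have : Uᴴ * fc U y * V = (Uᴴ * U) * diagonal (fun a => (y a : ℂ)) * (Uᴴ * V) := by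
        simp only [fc, Matrix.mul_assoc]
      rw [this, hU.1, Matrix.one_mul]
    · have : Uᴴ * fc V z * V = (Uᴴ * V) * diagonal (fun a => (z a : ℂ)) * (Vᴴ * V) := by
        simp only [fc, Matrix.mul_assoc]
      rw [this, hV.1, Matrix.mul_one]
  have cnje : ∀ (y z : N → ℝ) a b, (Uᴴ * (fc U y - fc V z) * V) a b
      = ((y a - z b : ℝ) : ℂ) * G a b := by
    intro y z a b
    rw [cnj, Matrix.sub_apply, diagonal_mul, mul_diagonal]; push_cast; ring
  have hBG : ∀ a b, ((l a - m b : ℝ) : ℂ) * G a b = 2 * B a b := by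
    intro a b
    rw [← cnje, h, Matrix.mul_smul, Matrix.smul_mul, Matrix.smul_apply, smul_eq_mul]
  have e1 : ∀ y z : N → ℝ, trace (A * (fc U y - fc V z))
      = ∑ a, ∑ b, star (B a b) * (((y a - z b : ℝ) : ℂ) * G a b) := by
    intro y z
    have hBh : Bᴴ = Vᴴ * A * U := by
      rw [hB, conjTranspose_mul, conjTranspose_mul, conjTranspose_conjTranspose, hA.eq,
        Matrix.mul_assoc]
    have : trace (A * (fc U y - fc V z)) = trace (Bᴴ * (Uᴴ * (fc U y - fc V z) * V)) := by
      have : Bᴴ * (Uᴴ * (fc U y - fc V z) * V) = Vᴴ * (A * (U * Uᴴ) * (fc U y - fc V z) * V) := by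
        rw [hBh]; simp only [Matrix.mul_assoc]
      rw [this, hU.2, Matrix.mul_one, trace_mul_comm Vᴴ, Matrix.mul_assoc _ V, hV.2, Matrix.mul_one]
    rw [this, trace, Finset.sum_comm]
    refine Finset.sum_congr rfl fun b _ => ?_
    rw [diag_apply, Matrix.mul_apply]
    refine Finset.sum_congr rfl fun a _ => ?_
    rw [conjTranspose_apply, cnje]
  rw [e1, trace_AfX hA hU hV, trace_AfY hA hU hV, Complex.ofReal_re, Complex.ofReal_re,
    Complex.re_sum, ← Finset.sum_add_distrib, Finset.mul_sum]
  refine Finset.sum_le_sum fun a _ => ?_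
  rw [Complex.re_sum, ← Finset.sum_add_distrib, Finset.mul_sum]
  refine Finset.sum_le_sum fun b _ => ?_
  have hn : 0 ≤ Complex.normSq (B a b) := Complex.normSq_nonneg _
  have hl := Real.rpow_nonneg (abs_nonneg (l a)) (r - 1)
  have hm := Real.rpow_nonneg (abs_nonneg (m b)) (r - 1)
  rcases eq_or_ne (l a) (m b) with he | he
  · rw [he]; simp only [sub_self, Complex.ofReal_zero, zero_mul, mul_zero, Complex.zero_re]
    rw [he] at hl
    positivity
  · have hs : l a - m b ≠ 0 := sub_ne_zero.2 he
    have hsc : ((l a - m b : ℝ) : ℂ) ≠ 0 := by exact_mod_cast hs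
    have hG' : G a b = 2 * B a b / ((l a - m b : ℝ) : ℂ) := by
      rw [eq_div_iff hsc, mul_comm]; exact hBG a b
    have hdd := dd_le hr (l a) (m b)
    have hq : (oddpow r (l a) - oddpow r (m b)) / (l a - m b)
        ≤ r * (|l a| ^ (r - 1) + |m b| ^ (r - 1)) := by
      have h2 : 0 < (l a - m b) ^ 2 := by positivity
      calc _ = (oddpow r (l a) - oddpow r (m b)) * (l a - m b) / (l a - m b) ^ 2 := by
            field_simp
        _ ≤ _ := by rw [div_le_iff₀ h2]; exact hdd
    have : star (B a b) * (((oddpow r (l a) - oddpow r (m b) : ℝ) : ℂ) * G a b)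
        = ((2 * Complex.normSq (B a b) * ((oddpow r (l a) - oddpow r (m b)) / (l a - m b)) : ℝ) : ℂ)
        := by
      rw [hG']
      have hnn := Complex.mul_conj (B a b)
      push_cast
      rw [← hnn, RCLike.star_def]
      push_cast at hsc
      ring
    rw [this, Complex.ofReal_re]
    have := mul_le_mul_of_nonneg_left hq (mul_nonneg zero_le_two hn)
    linarith

/-- noncommutative Khintchine type inequality. -/
lemma khintchine {ι : Type*} [Fintype ι] {A Q : ι → Matrix N N ℂ} (hA : ∀ i, (A i).IsHermitian)
    (hQ : ∀ i, (Q i).IsHermitian) (hQ2 : ∀ i, Q i * Q i = 1)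
    {U : Matrix N N ℂ} (hU : IsU U) {l : N → ℝ} (hS : fc U l = ∑ i, A i)
    (hQS : ∀ i, Q i * fc U l * Q i = fc U l - (2 : ℂ) • A i)
    (hQA : ∀ i, Q i * A i * Q i = - A i) (g : N → ℝ) (hg : ∀ x, 0 ≤ g x)
    (hAA : ∑ i, A i * A i = diagonal (fun x => ((g x ^ 2 : ℝ) : ℂ))) {p : ℝ} (hp : 2 ≤ p) :
    lpn p l ≤ Real.sqrt (2 * p) * lpn p g := by
  have hp0 : 0 < p := by linarith
  have hQU : ∀ i, IsU (Q i) := fun i => ⟨by rw [(hQ i).eq, hQ2], by rw [(hQ i).eq, hQ2]⟩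
  have hfcQ : ∀ i y, fc (Q i * U) y = Q i * fc U y * Q i := by
    intro i y
    rw [← fc_conj, (hQ i).eq]
  have key : ∀ i, (trace (A i * fc U (fun a => oddpow (p - 1) (l a)))).re
      ≤ 2 * (p - 1) * (trace (A i * A i * fc U (fun a => |l a| ^ (p - 1 - 1)))).re := by
    intro i
    have h := trace_doi (hA i) hU ((hQU i).mul hU) (l := l) (m := l)
      (by rw [hfcQ, hQS]; abel) (r := p - 1) (by linarith)
    rw [hfcQ, hfcQ, Matrix.mul_sub, trace_sub] at h
    have f1 : ∀ X : Matrix N N ℂ, trace (A i * (Q i * X * Q i)) = - trace (A i * X) := by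
      intro X
      have : trace (A i * (Q i * X * Q i)) = trace ((Q i * A i * Q i) * X) := by
        rw [← Matrix.mul_assoc, trace_mul_comm]; simp only [Matrix.mul_assoc]
      rw [this, hQA, Matrix.neg_mul, trace_neg]
    have f2 : ∀ X : Matrix N N ℂ, trace (A i * A i * (Q i * X * Q i)) = trace (A i * A i * X) := by
      intro X
      have h1 : trace (A i * A i * (Q i * X * Q i)) = trace ((Q i * (A i * A i) * Q i) * X) := by
        rw [← Matrix.mul_assoc, trace_mul_comm]; simp only [Matrix.mul_assoc]
      have h2 : Q i * (A i * A i) * Q i = (Q i * A i * Q i) * (Q i * A i * Q i) := by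
        have : (Q i * A i * Q i) * (Q i * A i * Q i) = Q i * A i * (Q i * Q i) * A i * Q i := by
          simp only [Matrix.mul_assoc]
        rw [this, hQ2, Matrix.mul_one]; simp only [Matrix.mul_assoc]
      rw [h1, h2, hQA, neg_mul_neg]
    rw [f1, f2, Complex.sub_re, Complex.neg_re] at h
    linarith
  have e1 : ∑ a, |l a| ^ p = ∑ i, (trace (A i * fc U (fun a => oddpow (p - 1) (l a)))).re := by
    rw [← Complex.re_sum, ← trace_sum, ← Matrix.sum_mul, ← hS, fc_mul hU, trace_fc hU,
      Complex.ofReal_re]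
    refine Finset.sum_congr rfl fun a _ => ?_
    rw [oddpow, sign_mul_rpow _ hp0 (by ring)]
  have e2 : ∑ i, (trace (A i * A i * fc U (fun a => |l a| ^ (p - 1 - 1)))).re
      = (trace (fc 1 (fun x => g x ^ 2) * fc U (fun a => |l a| ^ (p - 1 - 1)))).re := by
    rw [← Complex.re_sum, ← trace_sum, ← Matrix.sum_mul, hAA]
    simp [fc]
  have h3 : lpn p l ^ p ≤ 2 * (p - 1) *
      (trace (fc 1 (fun x => g x ^ 2) * fc U (fun a => |l a| ^ (p - 1 - 1)))).re := by
    rw [lpn_rpow hp0, e1, ← e2, Finset.mul_sum]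
    exact Finset.sum_le_sum fun i _ => key i
  have hT := lpn_nonneg p l
  have hR := lpn_nonneg p g
  have h4 : (trace (fc 1 (fun x => g x ^ 2) * fc U (fun a => |l a| ^ (p - 1 - 1)))).re
      ≤ lpn p g ^ 2 * lpn p l ^ (p - 2) := by
    rcases hp.eq_or_lt with h2 | h2
    · subst h2
      have : (2 : ℝ) - 1 - 1 = 0 := by norm_num
      simp only [this, sub_self, Real.rpow_zero]
      rw [fc_one hU, Matrix.mul_one, trace_fc isU_one, Complex.ofReal_re, mul_one,
        ← Real.rpow_natCast]
      push_cast
      rw [lpn_rpow hp0]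
      simp
    · have hq : (p / 2).HolderConjugate (p / (p - 2)) := by
        rw [Real.holderConjugate_iff]
        refine ⟨by linarith, ?_⟩
        have : p - 2 ≠ 0 := by linarith
        field_simp
        ring
      refine (holder isU_one hU _ _ hq).trans (le_of_eq ?_)
      have c1 : lpn (p / 2) (fun x => g x ^ 2) = lpn p g ^ (2 : ℝ) := by
        rw [← lpn_comp_rpow (q := p / 2) (r := 2) (by linarith) hp0 (by ring)]
        congr 1
        ext x
        rw [abs_of_nonneg (hg x)]; simp
      have c2 : lpn (p / (p - 2)) (fun a => |l a| ^ (p - 1 - 1)) = lpn p l ^ (p - 2) := by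
        have : p - 1 - 1 = p - 2 := by ring
        rw [this]
        have h0 : 0 < p - 2 := by linarith
        rw [lpn_comp_rpow (R := p) (by positivity) hp0 (by field_simp)]
      rw [c1, c2]; simp
  rcases hT.eq_or_lt with h0 | h0
  · rw [← h0]; positivity
  · have h5 : lpn p l ^ p = lpn p l ^ 2 * lpn p l ^ (p - 2) := by
      rw [← Real.rpow_natCast, ← Real.rpow_add h0]; congr 1; push_cast; ring
    have h6 : lpn p l ^ 2 * lpn p l ^ (p - 2) ≤ (2 * p * lpn p g ^ 2) * lpn p l ^ (p - 2) := by
      rw [← h5]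
      refine h3.trans ?_
      have := mul_le_mul_of_nonneg_left h4 (by linarith : 0 ≤ 2 * (p - 1))
      refine this.trans ?_
      have : 0 ≤ lpn p g ^ 2 * lpn p l ^ (p - 2) := by positivity
      nlinarith
    have h7 := le_of_mul_le_mul_right h6 (Real.rpow_pos_of_pos h0 _)
    refine le_of_sq_le_sq ?_ (by positivity)
    rw [mul_pow, Real.sq_sqrt (by positivity)]
    exact h7

end EPR
end

open scoped BigOperators
open Finset

noncomputable section
set_option linter.unusedSectionVars false
set_option linter.unusedSimpArgs false

namespace EPR

open Matrix

variable {n : ℕ}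

/-- the cube -/
abbrev Cube (n : ℕ) := Fin n → Bool

lemma rad_sq (b : Bool) : rad b * rad b = 1 := by cases b <;> simp [rad]

lemma rad_not (b : Bool) : rad (!b) = - rad b := by cases b <;> simp [rad]

lemma flip_invol (i : Fin n) : Function.Involutive (flipCoord i) := by
  intro y
  simp [flipCoord]

lemma flip_same (i : Fin n) (y : Cube n) : flipCoord i y i = !(y i) := by simp [flipCoord]

lemma flip_ne {i j : Fin n} (h : j ≠ i) (y : Cube n) : flipCoord i y j = y j := by
  simp [flipCoord, h]

lemma Dop_odd (i : Fin n) (f : Cube n → ℝ) (y : Cube n) :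
    Dop i f (flipCoord i y) = - Dop i f y := by
  simp only [Dop, flip_invol i y, smul_eq_mul]; ring

lemma walsh_flip {i : Fin n} {A : Finset (Fin n)} (h : i ∉ A) (y : Cube n) :
    walshChar A (flipCoord i y) = walshChar A y := by
  unfold walshChar
  refine Finset.prod_congr rfl fun j hj => ?_
  have hji : j ≠ i := by rintro rfl; exact h hj
  rw [flip_ne hji]

lemma wcoef_zero {i : Fin n} {F : Cube n → ℝ} (hF : ∀ y, F (flipCoord i y) = - F y)
    {A : Finset (Fin n)} (h : i ∉ A) : wcoef F A = 0 := by
  unfold wcoef cubeAvg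
  have : ∑ y, walshChar A y • F y = - ∑ y, walshChar A y • F y := by
    conv_lhs => rw [← Equiv.sum_comp ((flip_invol i).toPerm)]
    rw [← Finset.sum_neg_distrib]
    refine Finset.sum_congr rfl fun y _ => ?_
    simp only [Function.Involutive.coe_toPerm]
    rw [walsh_flip h, hF]; simp
  have h0 : ∑ y, walshChar A y • F y = 0 := by linarith
  rw [h0, smul_zero]

/-- sum over nonempty sets of functions supported on sets containing `i`. -/
lemma sum_contains (i : Fin n) (T : Finset (Fin n) → ℝ) (hT : ∀ A, i ∉ A → T A = 0) :
    ∑ A ∈ univ.filter (fun A : Finset (Fin n) => A ≠ ∅), T A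
      = ∑ B ∈ (univ.erase i).powerset, T (insert i B) := by
  have h1 : ∑ A ∈ univ.filter (fun A : Finset (Fin n) => A ≠ ∅), T A = ∑ A, T A := by
    rw [Finset.sum_filter]
    refine Finset.sum_congr rfl fun A _ => ?_
    split_ifs with h
    · rfl
    · push Not at h
      rw [hT A (by rw [h]; simp)]
  rw [h1, ← Finset.powerset_univ, ← Finset.insert_erase (mem_univ i),
    Finset.sum_powerset_insert (Finset.notMem_erase i univ)]
  rw [Finset.sum_eq_zero (fun t ht => hT t ?_), zero_add]
  · simp
  · intro hi
    have := Finset.mem_powerset.1 ht hi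
    simp at this

lemma kernel_two (i : Fin n) (x y : Cube n) (s c : ℝ) :
    ∑ B ∈ (univ.erase i).powerset, s * c ^ ((insert i B).card - 1) *
        (walshChar (insert i B) x * walshChar (insert i B) y)
      = s * (rad (x i) * rad (y i)) * ∏ j ∈ univ.erase i, (1 + c * (rad (x j) * rad (y j))) := by
  rw [Finset.prod_one_add, Finset.mul_sum]
  refine Finset.sum_congr rfl fun B hB => ?_
  have hi : i ∉ B := fun h => by
    have := Finset.mem_powerset.1 hB h
    simp at this
  rw [Finset.card_insert_of_notMem hi, Nat.add_sub_cancel]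
  unfold walshChar
  rw [Finset.prod_insert hi, Finset.prod_insert hi, Finset.prod_mul_distrib, Finset.prod_const,
    Finset.prod_mul_distrib]
  ring

/-- the function `V(θ,x)`. -/
def vfun (F : Fin n → Cube n → ℝ) (θ : ℝ) (x : Cube n) : ℝ :=
  ∑ i, ∑ A ∈ univ.filter (fun A : Finset (Fin n) => A ≠ ∅),
    Real.sin θ * Real.cos θ ^ (A.card - 1) * (walshChar A x * wcoef (F i) A)

lemma vfun_neg (F : Fin n → Cube n → ℝ) (θ : ℝ) (x : Cube n) :
    vfun F (-θ) x = - vfun F θ x := by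
  simp only [vfun, Real.sin_neg, Real.cos_neg, neg_mul, Finset.sum_neg_distrib]

lemma vfun_eq {F : Fin n → Cube n → ℝ} (hF : ∀ i y, F i (flipCoord i y) = - F i y) (θ : ℝ)
    (x : Cube n) :
    vfun F θ x = ∑ i, ∑ y, F i y * ((rad (x i) * rad (y i)) * Real.sin θ / 2 *
      ∏ j ∈ univ.erase i, ((1 + Real.cos θ * (rad (x j) * rad (y j))) / 2)) := by
  unfold vfun
  refine Finset.sum_congr rfl fun i _ => ?_
  rw [sum_contains i _ (fun A hA => by rw [wcoef_zero (hF i) hA]; ring)]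
  have h2 : ∀ y : Cube n, F i y * ((rad (x i) * rad (y i)) * Real.sin θ / 2 *
      ∏ j ∈ univ.erase i, ((1 + Real.cos θ * (rad (x j) * rad (y j))) / 2))
      = ∑ B ∈ (univ.erase i).powerset, (2 ^ n : ℝ)⁻¹ * F i y * (Real.sin θ *
        Real.cos θ ^ ((insert i B).card - 1) *
        (walshChar (insert i B) x * walshChar (insert i B) y)) := by
    intro y
    rw [← Finset.mul_sum, kernel_two, Finset.prod_div_distrib, Finset.prod_const,
      Finset.card_erase_of_mem (mem_univ i), Finset.card_univ, Fintype.card_fin]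
    have hn : (2 : ℝ) ^ n = 2 * 2 ^ (n - 1) := by
      rw [← pow_succ']; congr 1; have := i.pos; omega
    rw [hn]
    field_simp
  simp only [h2]
  rw [Finset.sum_comm]
  refine Finset.sum_congr rfl fun B _ => ?_
  unfold wcoef cubeAvg
  rw [smul_eq_mul, Finset.mul_sum, Finset.mul_sum, Finset.mul_sum]
  refine Finset.sum_congr rfl fun y _ => ?_
  rw [smul_eq_mul]; ring

/-- Walsh-Fourier matrix -/
def Wm (n : ℕ) : Matrix (Cube n) (Cube n) ℂ :=
  Matrix.of fun x y => (((Real.sqrt (2 ^ n))⁻¹ * ∏ j, (if y j then rad (x j) else 1) : ℝ) : ℂ)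

/-- degree -/
def dg (y : Cube n) : ℤ := ∑ j, if y j then 1 else 0

lemma Wm_sum (c : ℂ) (x z : Cube n) :
    ∑ y, Wm n x y * (∏ j, if y j then c else 1) * star (Wm n z y)
      = ∏ j, (1 + c * (rad (x j) * rad (z j) : ℝ)) / 2 := by
  have h1 : ∀ y, Wm n x y * (∏ j, if y j then c else 1) * star (Wm n z y)
      = ∏ j, ((if y j then c * (rad (x j) * rad (z j) : ℝ) else 1) / 2) := by
    intro y
    have hs : ((Real.sqrt (2 ^ n))⁻¹ * (Real.sqrt (2 ^ n))⁻¹ : ℝ) = ∏ j : Fin n, (1 / 2 : ℝ) := by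
      rw [← mul_inv, Real.mul_self_sqrt (by positivity)]; simp
    have : Wm n x y * (∏ j, if y j then c else 1) * star (Wm n z y)
        = (((Real.sqrt (2 ^ n))⁻¹ * (Real.sqrt (2 ^ n))⁻¹ : ℝ) : ℂ) *
          ((∏ j, (((if y j then rad (x j) else 1 : ℝ)) : ℂ)) * (∏ j, if y j then c else 1)
            * ∏ j, (((if y j then rad (z j) else 1 : ℝ)) : ℂ)) := by
      simp only [Wm, of_apply, RCLike.star_def, Complex.conj_ofReal]
      push_cast
      ring
    rw [this, hs]
    push_cast
    rw [← Finset.prod_mul_distrib, ← Finset.prod_mul_distrib, ← Finset.prod_mul_distrib]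
    refine Finset.prod_congr rfl fun j _ => ?_
    split_ifs
    · push_cast; ring
    · push_cast; ring
  simp only [h1]
  have := Fintype.prod_sum (κ := fun _ : Fin n => Bool) (fun j b =>
    (if b then c * (rad (x j) * rad (z j) : ℝ) else 1) / 2)
  rw [← this]
  refine Finset.prod_congr rfl fun j _ => ?_
  rw [Fintype.sum_bool]; simp; ring

lemma Wm_unit (n : ℕ) : IsU (Wm n) := by
  have h : Wm n * (Wm n)ᴴ = 1 := by
    ext x z
    rw [Matrix.mul_apply]
    have := Wm_sum 1 x z
    simp only [ite_self, Finset.prod_const_one, mul_one, one_mul] at this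
    simp only [conjTranspose_apply]
    rw [this]
    rcases eq_or_ne x z with h | h
    · subst h
      rw [one_apply_eq]
      refine Finset.prod_eq_one fun j _ => ?_
      rw [rad_sq]; norm_num
    · rw [one_apply_ne h]
      obtain ⟨j, hj⟩ := Function.ne_iff.1 h
      refine Finset.prod_eq_zero (mem_univ j) ?_
      have : rad (x j) * rad (z j) = -1 := by
        revert hj; cases x j <;> cases z j <;> simp [rad]
      rw [this]; norm_num
  exact ⟨mul_eq_one_comm.1 h, h⟩

/-- diagonal phases -/
def ph (n : ℕ) (θ : ℝ) : Matrix (Cube n) (Cube n) ℂ :=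
  diagonal fun y => ∏ j, if y j then Complex.exp (θ * Complex.I) else 1

lemma ph_eq (θ : ℝ) (y : Cube n) :
    (∏ j, if y j then Complex.exp (θ * Complex.I) else 1)
      = Complex.exp ((dg y * θ : ℝ) * Complex.I) := by
  unfold dg
  push_cast
  rw [Finset.sum_mul, Finset.sum_mul, Complex.exp_sum]
  refine Finset.prod_congr rfl fun j _ => ?_
  split_ifs <;> simp

lemma ph_unit (n : ℕ) (θ : ℝ) : IsU (ph n θ) := by
  have h : ph n θ * (ph n θ)ᴴ = 1 := by
    unfold ph
    simp only [ph_eq]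
    rw [diagonal_conjTranspose, diagonal_mul_diagonal, ← diagonal_one]
    congr 1
    ext y
    rw [Pi.star_apply, RCLike.star_def, Complex.mul_conj, Complex.normSq_eq_norm_sq,
      Complex.norm_exp_ofReal_mul_I]
    norm_num
  exact ⟨mul_eq_one_comm.1 h, h⟩

/-- rotation matrix -/
def Um (n : ℕ) (θ : ℝ) : Matrix (Cube n) (Cube n) ℂ := Wm n * ph n θ * (Wm n)ᴴ

lemma Um_unit (n : ℕ) (θ : ℝ) : IsU (Um n θ) := ((Wm_unit n).mul (ph_unit n θ)).mul (Wm_unit n).star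

lemma Um_apply (θ : ℝ) (x z : Cube n) :
    Um n θ x z = ∏ j, (1 + Complex.exp (θ * Complex.I) * (rad (x j) * rad (z j) : ℝ)) / 2 := by
  rw [← Wm_sum]
  unfold Um ph
  rw [Matrix.mul_apply]
  refine Finset.sum_congr rfl fun y _ => ?_
  rw [mul_diagonal, conjTranspose_apply]

/-- the noncommutative gradient matrices -/
def Am (F : Fin n → Cube n → ℝ) (i : Fin n) : Matrix (Cube n) (Cube n) ℂ :=
  Matrix.of fun x y => if y = flipCoord i x then -Complex.I * (F i x : ℝ) else 0

lemma ker_ne {c s t : ℝ} (h : c ^ 2 + s ^ 2 = 1) (ht : t ^ 2 = 1) :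
    (1 + ((c : ℂ) + s * Complex.I) * (t : ℝ)) / 2 * star ((1 + ((c : ℂ) + s * Complex.I) * (t : ℝ)) / 2)
      = (((1 + c * t) / 2 : ℝ) : ℂ) := by
  simp only [RCLike.star_def, map_div₀, map_add, map_mul, map_one, Complex.conj_ofReal,
      Complex.conj_I, map_ofNat]
  have h' : (c : ℂ) ^ 2 + (s : ℂ) ^ 2 = 1 := by exact_mod_cast h
  have ht' : (t : ℂ) ^ 2 = 1 := by exact_mod_cast ht
  push_cast
  linear_combination (1 / 4) * ((t : ℂ) ^ 2) * h' + (1 / 4) * ht'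
    - (1 / 4) * (t : ℂ) ^ 2 * (s : ℂ) ^ 2 * Complex.I_sq

lemma ker_eq {c s t : ℝ} (h : c ^ 2 + s ^ 2 = 1) (ht : t ^ 2 = 1) :
    (1 + ((c : ℂ) + s * Complex.I) * (t : ℝ)) / 2 * (-Complex.I)
        * star ((1 + ((c : ℂ) + s * Complex.I) * ((-t : ℝ) : ℂ)) / 2)
      = ((t * s / 2 : ℝ) : ℂ) := by
  simp only [RCLike.star_def, map_div₀, map_add, map_mul, map_one, Complex.conj_ofReal,
      Complex.conj_I, map_ofNat]
  have h' : (c : ℂ) ^ 2 + (s : ℂ) ^ 2 = 1 := by exact_mod_cast h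
  have ht' : (t : ℂ) ^ 2 = 1 := by exact_mod_cast ht
  push_cast
  linear_combination (1 / 4) * (Complex.I) * ((t : ℂ) ^ 2) * h' + (1 / 4) * Complex.I * ht'
      - (1 / 4) * (Complex.I * (t : ℂ) ^ 2 * (s : ℂ) ^ 2 + 2 * t * s) * Complex.I_sq

lemma kernel_one (i : Fin n) (θ : ℝ) (x y : Cube n) :
    Um n θ x y * (-Complex.I) * star (Um n θ x (flipCoord i y)) =
      (((rad (x i) * rad (y i)) * Real.sin θ / 2 *
      ∏ j ∈ univ.erase i, ((1 + Real.cos θ * (rad (x j) * rad (y j))) / 2) : ℝ) : ℂ) := by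
  have he : Complex.exp (θ * Complex.I) = Real.cos θ + Real.sin θ * Complex.I := by
    rw [Complex.exp_mul_I]; push_cast; rfl
  have hcs := Real.cos_sq_add_sin_sq θ
  have hr : ∀ j, (rad (x j) * rad (y j)) ^ 2 = 1 := by
    intro j
    rw [mul_pow, sq, sq, rad_sq, rad_sq, one_mul]
  rw [Um_apply, Um_apply, star_prod, ← Finset.mul_prod_erase univ _ (mem_univ i),
    ← Finset.mul_prod_erase univ (fun j => star _) (mem_univ i), he]
  have h1 : (∏ j ∈ univ.erase i,
        (1 + (Real.cos θ + Real.sin θ * Complex.I) * (rad (x j) * rad (y j) : ℝ)) / 2) *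
      (∏ j ∈ univ.erase i, star
        ((1 + (Real.cos θ + Real.sin θ * Complex.I) * (rad (x j) * rad (flipCoord i y j) : ℝ)) / 2))
      = ((∏ j ∈ univ.erase i, ((1 + Real.cos θ * (rad (x j) * rad (y j))) / 2) : ℝ) : ℂ) := by
    rw [← Finset.prod_mul_distrib, Complex.ofReal_prod]
    refine Finset.prod_congr rfl fun j hj => ?_
    rw [flip_ne (Finset.ne_of_mem_erase hj)]
    exact ker_ne hcs (hr j)
  have h2 := ker_eq hcs (hr i)
  have hneg : rad (x i) * rad (flipCoord i y i) = -(rad (x i) * rad (y i)) := by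
    rw [flip_same, rad_not]; ring
  rw [Complex.ofReal_mul (_ / 2), ← h1, ← h2, hneg]
  ring

lemma vfun_mat {F : Fin n → Cube n → ℝ} (hF : ∀ i y, F i (flipCoord i y) = - F i y) (θ : ℝ)
    (x : Cube n) :
    (Um n θ * (∑ i, Am F i) * (Um n θ)ᴴ) x x = (vfun F θ x : ℂ) := by
  rw [Matrix.mul_sum, Matrix.sum_mul, Matrix.sum_apply, vfun_eq hF]
  push_cast
  refine Finset.sum_congr rfl fun i _ => ?_
  rw [Matrix.mul_apply]
  have h1 : ∀ z, (Um n θ * Am F i) x z = Um n θ x (flipCoord i z) * (Complex.I * (F i z : ℝ)) := by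
    intro z
    rw [Matrix.mul_apply, Finset.sum_eq_single (flipCoord i z)]
    · simp only [Am, of_apply, flip_invol i z, if_true, hF i z]
      push_cast; ring
    · intro y _ hy
      simp only [Am, of_apply]
      rw [if_neg, mul_zero]
      rintro rfl
      exact hy (flip_invol i y).symm
    · simp
  simp only [h1]
  rw [← Equiv.sum_comp ((flip_invol i).toPerm)]
  refine Finset.sum_congr rfl fun y _ => ?_
  simp only [Function.Involutive.coe_toPerm]
  have := kernel_one i θ x y
  rw [flip_invol i y, hF i y, conjTranspose_apply]
  push_cast at this ⊢
  rw [← this]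
  ring

end EPR
end

open scoped BigOperators
open Finset

noncomputable section
set_option linter.unusedSectionVars false
set_option linter.unusedSimpArgs false

namespace EPR

open Matrix

variable {n : ℕ}

lemma flip_eq_iff (i : Fin n) (x y : Cube n) : y = flipCoord i x ↔ x = flipCoord i y := by
  constructor
  · rintro rfl; exact (flip_invol i x).symm
  · rintro rfl; exact (flip_invol i y).symm

lemma Am_herm {F : Fin n → Cube n → ℝ} (hF : ∀ i y, F i (flipCoord i y) = - F i y) (i : Fin n) :
    (Am F i).IsHermitian := by
  ext x y
  simp only [conjTranspose_apply, Am, of_apply]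
  by_cases h : y = flipCoord i x
  · rw [if_pos h, if_pos ((flip_eq_iff i x y).1 h), h, hF]
    simp
  · rw [if_neg h, if_neg (fun h' => h ((flip_eq_iff i x y).2 h'))]
    simp

/-- sign matrices -/
def Qm (i : Fin n) : Matrix (Cube n) (Cube n) ℂ := diagonal fun x => ((rad (x i) : ℝ) : ℂ)

lemma Qm_herm (i : Fin n) : (Qm i).IsHermitian := by
  unfold Matrix.IsHermitian Qm
  rw [diagonal_conjTranspose]
  congr 1
  ext x
  simp

lemma Qm_sq (i : Fin n) : Qm i * Qm i = 1 := by
  unfold Qm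
  rw [diagonal_mul_diagonal, ← diagonal_one]
  congr 1
  ext x
  rw [← Complex.ofReal_mul, rad_sq, Complex.ofReal_one]

lemma Qm_conj (i : Fin n) (X : Matrix (Cube n) (Cube n) ℂ) (x y : Cube n) :
    (Qm i * X * Qm i) x y = ((rad (x i) * rad (y i) : ℝ) : ℂ) * X x y := by
  unfold Qm
  rw [mul_diagonal, diagonal_mul]; push_cast; ring

lemma Qm_Am_same (F : Fin n → Cube n → ℝ) (i : Fin n) : Qm i * Am F i * Qm i = - Am F i := by
  ext x y
  rw [Qm_conj, Matrix.neg_apply]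
  simp only [Am, of_apply]
  split_ifs with h
  · rw [h, flip_same, rad_not, mul_neg, rad_sq]; push_cast; ring
  · simp

lemma Qm_Am_ne (F : Fin n → Cube n → ℝ) {i j : Fin n} (hij : i ≠ j) :
    Qm i * Am F j * Qm i = Am F j := by
  ext x y
  rw [Qm_conj]
  simp only [Am, of_apply]
  split_ifs with h
  · rw [h, flip_ne hij, rad_sq]; push_cast; ring
  · simp

lemma Qm_S (F : Fin n → Cube n → ℝ) (i : Fin n) :
    Qm i * (∑ j, Am F j) * Qm i = (∑ j, Am F j) - (2 : ℂ) • Am F i := by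
  rw [Matrix.mul_sum, Matrix.sum_mul, ← Finset.add_sum_erase univ _ (mem_univ i),
    ← Finset.add_sum_erase univ (fun j => Am F j) (mem_univ i), Qm_Am_same]
  have : ∑ j ∈ univ.erase i, Qm i * Am F j * Qm i = ∑ j ∈ univ.erase i, Am F j :=
    Finset.sum_congr rfl fun j hj => Qm_Am_ne F (Finset.ne_of_mem_erase hj).symm
  rw [this, two_smul]
  abel

lemma Am_sq {F : Fin n → Cube n → ℝ} (hF : ∀ i y, F i (flipCoord i y) = - F i y) (i : Fin n) :
    Am F i * Am F i = diagonal fun x => ((F i x ^ 2 : ℝ) : ℂ) := by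
  ext x z
  rw [Matrix.mul_apply, Finset.sum_eq_single (flipCoord i x)]
  · simp only [Am, of_apply, if_true, flip_invol i x, hF, diagonal_apply]
    by_cases h : x = z
    · rw [if_pos h, if_pos h.symm]
      push_cast
      linear_combination (-(F i x : ℂ) ^ 2) * Complex.I_sq
    · rw [if_neg h, if_neg (Ne.symm h), mul_zero]
  · intro y _ hy
    simp only [Am, of_apply]
    rw [if_neg hy, zero_mul]
  · simp

lemma S_bound {F : Fin n → Cube n → ℝ} (hF : ∀ i y, F i (flipCoord i y) = - F i y)
    {U : Matrix (Cube n) (Cube n) ℂ} (hU : IsU U) {l : Cube n → ℝ} (hS : fc U l = ∑ i, Am F i)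
    {p : ℝ} (hp : 2 ≤ p) :
    lpn p l ≤ Real.sqrt (2 * p) * lpn p (fun x => Real.sqrt (∑ i, F i x ^ 2)) := by
  refine khintchine (A := Am F) (Q := Qm) (Am_herm hF) Qm_herm Qm_sq hU hS ?_ (Qm_Am_same F) _
    (fun x => Real.sqrt_nonneg _) ?_ hp
  · intro i; rw [hS]; exact Qm_S F i
  · ext x z
    rw [Matrix.sum_apply]
    simp only [Am_sq hF, diagonal_apply]
    by_cases h : x = z
    · simp only [if_pos h]
      rw [Real.sq_sqrt (Finset.sum_nonneg fun _ _ => sq_nonneg _)]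
      push_cast; rfl
    · simp only [if_neg h, Finset.sum_const_zero]

lemma vfun_le {F : Fin n → Cube n → ℝ} (hF : ∀ i y, F i (flipCoord i y) = - F i y)
    {U : Matrix (Cube n) (Cube n) ℂ} (hU : IsU U) {l : Cube n → ℝ} (hS : fc U l = ∑ i, Am F i)
    {p : ℝ} (hp : 1 ≤ p) (θ : ℝ) : lpn p (vfun F θ) ≤ lpn p l := by
  have h := diag_le ((Um_unit n θ).mul hU) l hp
  rw [← fc_conj, hS] at h
  simpa only [vfun_mat hF, Complex.ofReal_re] using h

lemma conj_entry (K : Matrix (Cube n) (Cube n) ℂ) (x : Cube n) :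
    (Wm n * K * (Wm n)ᴴ) x x = ∑ a, ∑ b, Wm n x a * K a b * star (Wm n x b) := by
  rw [Matrix.mul_apply, Finset.sum_comm]
  refine Finset.sum_congr rfl fun b _ => ?_
  rw [Matrix.mul_apply, Finset.sum_mul]
  rfl

lemma vfun_freq {F : Fin n → Cube n → ℝ} (hF : ∀ i y, F i (flipCoord i y) = - F i y)
    (x : Cube n) : ∃ r : Cube n → Cube n → ℝ,
      (∀ θ, vfun F θ x = ∑ a, ∑ b, r a b * Real.sin (((dg a - dg b : ℤ) : ℝ) * θ)) ∧
      ((Wm n * Hs dg ((Wm n)ᴴ * (∑ i, Am F i) * Wm n) * (Wm n)ᴴ) x x).re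
        = - ∑ a, ∑ b, r a b * ((Int.sign (dg a - dg b) : ℤ) : ℝ) := by
  set K := (Wm n)ᴴ * (∑ i, Am F i) * Wm n with hK
  refine ⟨fun a b => (Complex.I * (Wm n x a * K a b * star (Wm n x b))).re, ?_, ?_⟩
  · have h1 : ∀ θ, (vfun F θ x : ℂ) = ∑ a, ∑ b, (Wm n x a * K a b * star (Wm n x b)) *
        Complex.exp ((((dg a - dg b : ℤ) : ℝ) * θ : ℝ) * Complex.I) := by
      intro θ
      rw [← vfun_mat hF]
      have : Um n θ * (∑ i, Am F i) * (Um n θ)ᴴ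
          = Wm n * (ph n θ * K * (ph n θ)ᴴ) * (Wm n)ᴴ := by
        unfold Um
        rw [hK, conjTranspose_mul, conjTranspose_mul, conjTranspose_conjTranspose]
        simp only [Matrix.mul_assoc]
      rw [this, conj_entry]
      refine Finset.sum_congr rfl fun a _ => Finset.sum_congr rfl fun b _ => ?_
      unfold ph
      rw [diagonal_conjTranspose, mul_diagonal, diagonal_mul, Pi.star_apply, ph_eq, ph_eq]
      have : Complex.exp ((((dg a - dg b : ℤ) : ℝ) * θ : ℝ) * Complex.I)
          = Complex.exp ((dg a * θ : ℝ) * Complex.I)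
            * star (Complex.exp ((dg b * θ : ℝ) * Complex.I)) := by
        rw [RCLike.star_def, ← Complex.exp_conj, ← Complex.exp_add]
        congr 1
        simp only [map_mul, Complex.conj_ofReal, Complex.conj_I]
        push_cast
        ring
      rw [this]
      ring
    intro θ
    have h2 : (vfun F θ x : ℂ) = ∑ a, ∑ b, (Wm n x a * K a b * star (Wm n x b)) *
        (Complex.I * (Real.sin (((dg a - dg b : ℤ) : ℝ) * θ) : ℝ)) := by
      have e : (vfun F θ x : ℂ) = ((vfun F θ x : ℂ) - (vfun F (-θ) x : ℂ)) / 2 := by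
        rw [vfun_neg]; push_cast; ring
      rw [e, h1, h1, ← Finset.sum_sub_distrib, Finset.sum_div]
      refine Finset.sum_congr rfl fun a _ => ?_
      rw [← Finset.sum_sub_distrib, Finset.sum_div]
      refine Finset.sum_congr rfl fun b _ => ?_
      rw [Complex.exp_mul_I, Complex.exp_mul_I]
      rw [mul_neg, Complex.ofReal_neg, Complex.cos_neg, Complex.sin_neg, Complex.ofReal_sin]
      ring
    have h3 := congrArg Complex.re h2
    rw [Complex.ofReal_re, Complex.re_sum] at h3
    rw [h3]
    refine Finset.sum_congr rfl fun a _ => ?_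
    rw [Complex.re_sum]
    refine Finset.sum_congr rfl fun b _ => ?_
    rw [← mul_assoc, Complex.re_mul_ofReal, mul_comm _ Complex.I]
  · rw [conj_entry, Complex.re_sum, ← Finset.sum_neg_distrib]
    refine Finset.sum_congr rfl fun a _ => ?_
    rw [Complex.re_sum, ← Finset.sum_neg_distrib]
    refine Finset.sum_congr rfl fun b _ => ?_
    have : Wm n x a * Hs dg K a b * star (Wm n x b)
        = - (Complex.I * (Wm n x a * K a b * star (Wm n x b)) *
          (((Int.sign (dg a - dg b) : ℤ) : ℝ) : ℂ)) := by
      simp only [Hs, of_apply]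
      push_cast
      ring
    rw [this, Complex.neg_re, Complex.re_mul_ofReal]

end EPR
end

open scoped BigOperators
open Finset

noncomputable section
set_option linter.unusedSectionVars false
set_option linter.unusedSimpArgs false

namespace EPR

open MeasureTheory

/-- integrable with given integral -/
def HI (f : ℝ → ℝ) (s : Set ℝ) (v : ℝ) : Prop := IntegrableOn f s ∧ ∫ t in s, f t = v

lemma HI.congr {f g : ℝ → ℝ} {s : Set ℝ} {v : ℝ} (h : HI f s v) (hs : MeasurableSet s)
    (hfg : ∀ t ∈ s, f t = g t) : HI g s v :=
  ⟨h.1.congr_fun hfg hs, by rw [← h.2]; exact (setIntegral_congr_fun hs hfg).symm⟩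

lemma HI.add {f g : ℝ → ℝ} {s : Set ℝ} {v w : ℝ} (h : HI f s v) (h' : HI g s w) :
    HI (fun t => f t + g t) s (v + w) :=
  ⟨Integrable.add h.1 h'.1, by rw [integral_add h.1 h'.1, h.2, h'.2]⟩

lemma HI.cmul {f : ℝ → ℝ} {s : Set ℝ} {v : ℝ} (c : ℝ) (h : HI f s v) :
    HI (fun t => c * f t) s (c * v) :=
  ⟨Integrable.const_mul h.1 c, by rw [integral_const_mul, h.2]⟩

lemma HI.sum {ι : Type*} (S : Finset ι) {f : ι → ℝ → ℝ} {s : Set ℝ} {v : ι → ℝ}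
    (h : ∀ i ∈ S, HI (f i) s (v i)) : HI (fun t => ∑ i ∈ S, f i t) s (∑ i ∈ S, v i) :=
  ⟨integrable_finsetSum S (fun i hi => (h i hi).1), by
    rw [integral_finsetSum S (fun i hi => (h i hi).1)]
    exact Finset.sum_congr rfl fun i hi => (h i hi).2⟩

/-- the weight -/
def phi (θ : ℝ) : ℝ := 1 / Real.sqrt (-2 * Real.log (Real.cos θ))

lemma exp_lt_one' {s : ℝ} (hs : 0 < s) : Real.exp (-(s ^ 2 / 2)) < 1 := by
  rw [Real.exp_lt_one_iff]; have : 0 < s ^ 2 := by positivity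
  linarith

lemma image_arccos :
    (fun s : ℝ => Real.arccos (Real.exp (-(s ^ 2 / 2)))) '' Set.Ioi 0 = Set.Ioo 0 (Real.pi / 2) := by
  ext θ
  constructor
  · rintro ⟨s, hs, rfl⟩
    exact ⟨Real.arccos_pos.2 (exp_lt_one' hs), Real.arccos_lt_pi_div_two.2 (Real.exp_pos _)⟩
  · rintro ⟨h0, h1⟩
    have hc : 0 < Real.cos θ := Real.cos_pos_of_mem_Ioo ⟨by linarith, h1⟩
    have hc1 : Real.cos θ < 1 := by
      rw [← Real.cos_zero]
      exact Real.cos_lt_cos_of_nonneg_of_le_pi le_rfl (by linarith [Real.pi_pos]) h0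
    have hl : 0 < -2 * Real.log (Real.cos θ) := by
      have := Real.log_neg hc hc1; linarith
    refine ⟨Real.sqrt (-2 * Real.log (Real.cos θ)), Real.sqrt_pos.2 hl, ?_⟩
    simp only
    rw [Real.sq_sqrt hl.le]
    have : -(-2 * Real.log (Real.cos θ) / 2) = Real.log (Real.cos θ) := by ring
    rw [this, Real.exp_log hc, Real.arccos_cos h0.le (by linarith [Real.pi_pos])]

lemma int_phi {k : ℕ} (hk : k ≠ 0) :
    HI (fun θ => phi θ * (Real.sin θ * Real.cos θ ^ (k - 1))) (Set.Ioo 0 (Real.pi / 2))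
      (Real.sqrt (Real.pi / 2) * (k : ℝ) ^ (-(1 / 2) : ℝ)) := by
  have hk0 : (0 : ℝ) < k := by positivity
  have hd : ∀ s ∈ Set.Ioi (0 : ℝ), HasDerivWithinAt
      (fun s : ℝ => Real.arccos (Real.exp (-(s ^ 2 / 2))))
      (s * Real.exp (-(s ^ 2 / 2)) / Real.sqrt (1 - Real.exp (-(s ^ 2 / 2)) ^ 2)) (Set.Ioi 0) s := by
    intro s hs
    have h1 : HasDerivAt (fun s : ℝ => Real.exp (-(s ^ 2 / 2)))
        (Real.exp (-(s ^ 2 / 2)) * (-s)) s := by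
      have : HasDerivAt (fun s : ℝ => -(s ^ 2 / 2)) (-s) s := by
        have := ((hasDerivAt_pow 2 s).div_const 2).neg
        exact this.congr_deriv (by norm_num)
      exact this.exp
    have h2 := (Real.hasDerivAt_arccos (x := Real.exp (-(s ^ 2 / 2)))
      (by have := Real.exp_pos (-(s ^ 2 / 2)); linarith) (exp_lt_one' hs).ne).comp s h1
    refine HasDerivAt.hasDerivWithinAt ?_
    exact h2.congr_deriv (by ring)
  have hinj : Set.InjOn (fun s : ℝ => Real.arccos (Real.exp (-(s ^ 2 / 2)))) (Set.Ioi 0) := by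
    intro s hs t ht hst
    have hs' : (0 : ℝ) < s := hs
    have ht' : (0 : ℝ) < t := ht
    have := Real.arccos_injOn ⟨by linarith [Real.exp_pos (-(s ^ 2 / 2))], (exp_lt_one' hs').le⟩
      ⟨by linarith [Real.exp_pos (-(t ^ 2 / 2))], (exp_lt_one' ht').le⟩ hst
    have := Real.exp_injective this
    have h2 : s ^ 2 = t ^ 2 := by linarith
    exact (pow_left_inj₀ hs'.le ht'.le two_ne_zero).1 h2
  have hval : ∀ s ∈ Set.Ioi (0 : ℝ),
      Real.exp (-(k / 2 : ℝ) * s ^ 2) =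
      |s * Real.exp (-(s ^ 2 / 2)) / Real.sqrt (1 - Real.exp (-(s ^ 2 / 2)) ^ 2)| •
      (fun θ => phi θ * (Real.sin θ * Real.cos θ ^ (k - 1)))
        (Real.arccos (Real.exp (-(s ^ 2 / 2)))) := by
    intro s hs
    have hs' : (0 : ℝ) < s := hs
    have he := Real.exp_pos (-(s ^ 2 / 2))
    have he1 := exp_lt_one' hs'
    have hpos : 0 < Real.sqrt (1 - Real.exp (-(s ^ 2 / 2)) ^ 2) := by
      apply Real.sqrt_pos.2; nlinarith
    simp only [phi]
    rw [Real.cos_arccos (by linarith) he1.le, Real.sin_arccos, Real.log_exp, abs_of_pos (by positivity),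
      smul_eq_mul]
    have : -2 * -(s ^ 2 / 2) = s ^ 2 := by ring
    rw [this, Real.sqrt_sq hs'.le]
    have hE : Real.exp (-(k / 2 : ℝ) * s ^ 2)
        = Real.exp (-(s ^ 2 / 2)) * Real.exp (-(s ^ 2 / 2)) ^ (k - 1) := by
      rw [← pow_succ', Nat.sub_add_cancel (Nat.one_le_iff_ne_zero.2 hk), ← Real.exp_nat_mul]
      congr 1; ring
    rw [hE]
    field_simp
  have hG : HI (fun s => Real.exp (-(k / 2 : ℝ) * s ^ 2)) (Set.Ioi 0)
      (Real.sqrt (Real.pi / 2) * (k : ℝ) ^ (-(1 / 2) : ℝ)) := by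
    refine ⟨(integrable_exp_neg_mul_sq (by positivity)).integrableOn, ?_⟩
    rw [integral_gaussian_Ioi, Real.rpow_neg hk0.le, ← Real.sqrt_eq_rpow, ← Real.sqrt_inv,
      ← Real.sqrt_mul (by positivity)]
    have : Real.pi / (k / 2) = 2 ^ 2 * (Real.pi / 2 * (k : ℝ)⁻¹) := by field_simp
    rw [this, Real.sqrt_mul (by positivity), Real.sqrt_sq (by norm_num)]
    ring
  have hGG := hG.congr measurableSet_Ioi hval
  rw [← image_arccos]
  constructor
  · rw [integrableOn_image_iff_integrableOn_abs_deriv_smul measurableSet_Ioi hd hinj]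
    exact hGG.1
  · rw [integral_image_eq_integral_abs_deriv_smul measurableSet_Ioi hd hinj]
    exact hGG.2

/-- half-angle cotangent -/
def cth (θ : ℝ) : ℝ := Real.cos (θ / 2) / Real.sin (θ / 2)

lemma int_cos (j : ℕ) : HI (fun θ => Real.cos (j * θ)) (Set.Ioo 0 Real.pi)
    (if j = 0 then Real.pi else 0) := by
  constructor
  · exact ((by fun_prop : Continuous fun θ : ℝ => Real.cos (j * θ)).integrableOn_Icc).mono_set
      Set.Ioo_subset_Icc_self
  · rw [← integral_Ioc_eq_integral_Ioo, ← intervalIntegral.integral_of_le Real.pi_pos.le]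
    split_ifs with h
    · subst h; simp
    · have hj : (j : ℝ) ≠ 0 := by exact_mod_cast h
      rw [intervalIntegral.integral_comp_mul_left (fun t => Real.cos t) hj, integral_cos,
        Real.sin_nat_mul_pi]
      simp

lemma int_cth_nat (j : ℕ) : HI (fun θ => cth θ * Real.sin (j * θ)) (Set.Ioo 0 Real.pi)
    (if j = 0 then 0 else Real.pi) := by
  induction j with
  | zero => simp [HI]
  | succ j ih =>
    have h := (ih.add (int_cos (j + 1))).add (int_cos j)
    have h' := h.congr (g := fun θ => cth θ * Real.sin ((j + 1 : ℕ) * θ)) measurableSet_Ioo (by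
      intro θ hθ
      have hs : Real.sin (θ / 2) ≠ 0 :=
        (Real.sin_pos_of_pos_of_lt_pi (by linarith [hθ.1]) (by linarith [hθ.1, hθ.2])).ne'
      unfold cth
      obtain ⟨u, rfl⟩ : ∃ u, θ = 2 * u := ⟨θ / 2, by ring⟩
      have e0 : 2 * u / 2 = u := by ring
      rw [e0] at hs ⊢
      push_cast
      have e1 : (j + 1 : ℝ) * (2 * u) = ((2 * j + 1) * u) + u := by ring
      have e2 : (j : ℝ) * (2 * u) = ((2 * j + 1) * u) - u := by ring
      rw [e1, e2, Real.sin_add, Real.sin_sub, Real.cos_add, Real.cos_sub]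
      field_simp
      ring)
    convert h' using 1
    by_cases hj : j = 0 <;> simp [hj]

lemma int_cth (j : ℤ) : HI (fun θ => cth θ * Real.sin (j * θ)) (Set.Ioo 0 Real.pi)
    (Real.pi * ((Int.sign j : ℤ) : ℝ)) := by
  rcases lt_trichotomy j 0 with h | h | h
  · obtain ⟨m, rfl⟩ : ∃ m : ℕ, j = -(m : ℤ) := ⟨j.natAbs, by omega⟩
    have hm : m ≠ 0 := by rintro rfl; simp at h
    have hnn := ((int_cth_nat m).cmul (-1)).congr (g := fun θ => cth θ * Real.sin ((-(m : ℤ) : ℤ) * θ))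
      measurableSet_Ioo (by
        intro θ _
        push_cast
        rw [neg_mul (m : ℝ) θ, Real.sin_neg]; ring)
    rw [if_neg hm] at hnn
    rw [Int.sign_eq_neg_one_of_neg h]
    convert hnn using 1
    push_cast; ring
  · subst h; simp [HI]
  · obtain ⟨m, rfl⟩ : ∃ m : ℕ, j = (m : ℤ) := ⟨j.natAbs, by omega⟩
    have hm : m ≠ 0 := by rintro rfl; simp at h
    have hnn := int_cth_nat m
    rw [if_neg hm] at hnn
    rw [Int.sign_eq_one_of_pos h]
    simpa only [Int.cast_natCast, Int.cast_one, mul_one] using (hnn)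

/-- bounded kernel -/
def psi (θ : ℝ) : ℝ := (Set.Ioo 0 (Real.pi / 2)).indicator phi θ - 1 / 2 * cth θ

lemma psi_le {θ : ℝ} (hθ : θ ∈ Set.Ioo 0 Real.pi) : |psi θ| ≤ 1 := by
  have hpi := Real.pi_pos
  unfold psi
  have hs2 : 0 < Real.sin (θ / 2) :=
    Real.sin_pos_of_pos_of_lt_pi (by linarith [hθ.1]) (by linarith [hθ.1, hθ.2])
  have hc2 : 0 < Real.cos (θ / 2) :=
    Real.cos_pos_of_mem_Ioo ⟨by linarith [hθ.1], by linarith [hθ.2]⟩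
  have hsin : Real.sin θ = 2 * Real.sin (θ / 2) * Real.cos (θ / 2) := by
    rw [← Real.sin_two_mul]; congr 1; ring
  have hcos : Real.cos θ = 2 * Real.cos (θ / 2) ^ 2 - 1 := by
    rw [← Real.cos_two_mul]; congr 1; ring
  have hcs := Real.sin_sq_add_cos_sq (θ / 2)
  by_cases h : θ ∈ Set.Ioo 0 (Real.pi / 2)
  · rw [Set.indicator_of_mem h]
    have hc : 0 < Real.cos θ := Real.cos_pos_of_mem_Ioo ⟨by linarith [h.1], h.2⟩
    have hs : 0 < Real.sin θ := Real.sin_pos_of_pos_of_lt_pi hθ.1 hθ.2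
    have hcs' := Real.sin_sq_add_cos_sq θ
    have hL : -2 * Real.log (Real.cos θ) = - Real.log (Real.cos θ ^ 2) := by
      rw [Real.log_pow]; push_cast; ring
    have hL1 : Real.sin θ ^ 2 ≤ -2 * Real.log (Real.cos θ) := by
      have := Real.log_le_sub_one_of_pos (pow_pos hc 2)
      rw [hL]; linarith
    have hL2 : -2 * Real.log (Real.cos θ) ≤ (Real.sin θ / Real.cos θ) ^ 2 := by
      have := Real.log_le_sub_one_of_pos (inv_pos.2 (pow_pos hc 2))
      rw [Real.log_inv] at this
      rw [hL]
      refine this.trans (le_of_eq ?_)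
      rw [div_pow, eq_div_iff (pow_pos hc 2).ne', sub_mul, inv_mul_cancel₀ (pow_pos hc 2).ne']
      linarith
    have hLpos : 0 < -2 * Real.log (Real.cos θ) := lt_of_lt_of_le (pow_pos hs 2) hL1
    have hp1 : phi θ ≤ 1 / Real.sin θ := by
      unfold phi
      exact one_div_le_one_div_of_le hs (Real.le_sqrt_of_sq_le hL1)
    have hp2 : Real.cos θ / Real.sin θ ≤ phi θ := by
      unfold phi
      have := one_div_le_one_div_of_le (Real.sqrt_pos.2 hLpos)
        (Real.sqrt_le_sqrt hL2)
      rw [Real.sqrt_sq (div_pos hs hc).le, one_div_div] at this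
      exact this
    have hcc : 1 / 2 * cth θ = (1 + Real.cos θ) / (2 * Real.sin θ) := by
      unfold cth
      rw [hsin, hcos]; field_simp; ring
    rw [hcc]
    have hcle : Real.cos θ ≤ 1 := Real.cos_le_one θ
    have hsle : 1 - Real.cos θ ≤ Real.sin θ := by nlinarith
    have b1 : Real.cos θ / Real.sin θ - (1 + Real.cos θ) / (2 * Real.sin θ) ≥ -1 := by
      rw [ge_iff_le, ← sub_nonneg]
      have : Real.cos θ / Real.sin θ - (1 + Real.cos θ) / (2 * Real.sin θ) - -1
        = (Real.cos θ - 1 + 2 * Real.sin θ) / (2 * Real.sin θ) := by field_simp; ring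
      rw [this]; apply div_nonneg <;> linarith
    have b2 : 1 / Real.sin θ - (1 + Real.cos θ) / (2 * Real.sin θ) ≤ 1 := by
      rw [← sub_nonneg]
      have : 1 - (1 / Real.sin θ - (1 + Real.cos θ) / (2 * Real.sin θ))
        = (Real.cos θ - 1 + 2 * Real.sin θ) / (2 * Real.sin θ) := by field_simp; ring
      rw [this]; apply div_nonneg <;> linarith
    rw [abs_le]; constructor <;> linarith
  · rw [Set.indicator_of_notMem h, zero_sub, abs_neg]
    have hge : Real.pi / 2 ≤ θ := by
      by_contra hlt; exact h ⟨hθ.1, by linarith⟩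
    have hc : Real.cos θ ≤ 0 := Real.cos_nonpos_of_pi_div_two_le_of_le hge (by linarith [hθ.2])
    have hle : Real.cos (θ / 2) ≤ Real.sin (θ / 2) := by
      apply le_of_sq_le_sq _ hs2.le; nlinarith
    have : cth θ ≤ 1 := by unfold cth; rw [div_le_one hs2]; exact hle
    have h0 : 0 ≤ cth θ := (div_pos hc2 hs2).le
    rw [abs_of_nonneg (by linarith)]; linarith

end EPR
end

open scoped BigOperators
open Finset

noncomputable section
set_option linter.unusedSectionVars false
set_option linter.unusedSimpArgs false

namespace EPR

open MeasureTheory Matrix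

variable {n : ℕ}

/-- diagonal of the transferred Hilbert transform -/
def HH (F : Fin n → Cube n → ℝ) (x : Cube n) : ℝ :=
  ((Wm n * Hs dg ((Wm n)ᴴ * (∑ i, Am F i) * Wm n) * (Wm n)ᴴ) x x).re

lemma phi_part (F : Fin n → Cube n → ℝ) (x : Cube n) :
    HI (fun θ => phi θ * vfun F θ x) (Set.Ioo 0 (Real.pi / 2))
      (Real.sqrt (Real.pi / 2) * ∑ i, lapPow (-(1 / 2)) (F i) x) := by
  have h := HI.sum univ (s := Set.Ioo 0 (Real.pi / 2)) (fun i _ =>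
    HI.sum (univ.filter (fun A : Finset (Fin n) => A ≠ ∅)) (fun A hA =>
      (int_phi (k := A.card) (by
        rw [Finset.mem_filter] at hA
        exact fun h0 => hA.2 (Finset.card_eq_zero.1 h0))).cmul (walshChar A x * wcoef (F i) A)))
  have h2 := h.congr (g := fun θ => phi θ * vfun F θ x) measurableSet_Ioo (by
    intro θ _
    unfold vfun
    simp only [Finset.mul_sum]
    refine Finset.sum_congr rfl fun i _ => Finset.sum_congr rfl fun A _ => ?_
    ring)
  convert h2 using 1
  unfold lapPow
  simp only [Finset.mul_sum, smul_eq_mul]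
  refine Finset.sum_congr rfl fun i _ => Finset.sum_congr rfl fun A _ => ?_
  ring

lemma phi_part' (F : Fin n → Cube n → ℝ) (x : Cube n) :
    HI (fun θ => (Set.Ioo 0 (Real.pi / 2)).indicator phi θ * vfun F θ x) (Set.Ioo 0 Real.pi)
      (Real.sqrt (Real.pi / 2) * ∑ i, lapPow (-(1 / 2)) (F i) x) := by
  have h := phi_part F x
  have hfun : (fun θ => (Set.Ioo 0 (Real.pi / 2)).indicator phi θ * vfun F θ x)
      = (Set.Ioo 0 (Real.pi / 2)).indicator (fun θ => phi θ * vfun F θ x) := by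
    funext θ
    by_cases hθ : θ ∈ Set.Ioo 0 (Real.pi / 2)
    · rw [Set.indicator_of_mem hθ, Set.indicator_of_mem hθ]
    · rw [Set.indicator_of_notMem hθ, Set.indicator_of_notMem hθ, zero_mul]
  rw [hfun]
  have hsub : Set.Ioo 0 Real.pi ∩ Set.Ioo 0 (Real.pi / 2) = Set.Ioo 0 (Real.pi / 2) :=
    Set.inter_eq_right.2 (Set.Ioo_subset_Ioo_right (by linarith [Real.pi_pos]))
  constructor
  · exact ((integrable_indicator_iff measurableSet_Ioo).2 h.1).integrableOn
  · rw [setIntegral_indicator measurableSet_Ioo, hsub]; exact h.2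

lemma psi_int {F : Fin n → Cube n → ℝ} (hF : ∀ i y, F i (flipCoord i y) = - F i y) (x : Cube n) :
    HI (fun θ => psi θ * vfun F θ x) (Set.Ioo 0 Real.pi)
      (Real.sqrt (Real.pi / 2) * ∑ i, lapPow (-(1 / 2)) (F i) x + Real.pi / 2 * HH F x) := by
  obtain ⟨r, hr1, hr2⟩ := vfun_freq hF x
  have h1 := HI.sum univ (s := Set.Ioo 0 Real.pi) (fun a _ => HI.sum univ (fun b _ =>
    (int_cth (dg a - dg b)).cmul (r a b)))
  have h2 := ((phi_part' F x).add (h1.cmul (-(1 / 2)))).congr (g := fun θ => psi θ * vfun F θ x)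
    measurableSet_Ioo (by
      intro θ _
      have e : ∑ a, ∑ b, r a b * (cth θ * Real.sin (((dg a - dg b : ℤ) : ℝ) * θ))
          = cth θ * vfun F θ x := by
        rw [hr1]
        simp only [Finset.mul_sum]
        refine Finset.sum_congr rfl fun i _ => Finset.sum_congr rfl fun A _ => ?_
        ring
      rw [e, psi]; ring)
  convert h2 using 2
  have e : ∑ a, ∑ b, r a b * (Real.pi * ((Int.sign (dg a - dg b) : ℤ) : ℝ))
      = Real.pi * ∑ a, ∑ b, r a b * ((Int.sign (dg a - dg b) : ℤ) : ℝ) := by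
    simp only [Finset.mul_sum]
    refine Finset.sum_congr rfl fun i _ => Finset.sum_congr rfl fun A _ => ?_
    ring
  rw [e, HH, hr2]; ring

lemma mink {F : Fin n → Cube n → ℝ} {p M : ℝ} (hp : 2 ≤ p) (w : Cube n → ℝ)
    (hw : ∀ x, HI (fun θ => psi θ * vfun F θ x) (Set.Ioo 0 Real.pi) (w x))
    (hM : ∀ θ, lpn p (vfun F θ) ≤ M) : lpn p w ≤ Real.pi * M := by
  have hM0 : 0 ≤ M := (lpn_nonneg _ _).trans (hM 0)
  rcases (lpn_nonneg p w).eq_or_lt with h0 | h0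
  · rw [← h0]; positivity
  have hpq := Real.HolderConjugate.conjExponent (p := p) (by linarith)
  obtain ⟨g, hg1, hg2⟩ := exists_dual hpq w h0
  have h := HI.sum univ (s := Set.Ioo 0 Real.pi) (fun x _ => (hw x).cmul (g x))
  have hb : ∀ θ ∈ Set.Ioo 0 Real.pi, ‖∑ x, g x * (psi θ * vfun F θ x)‖ ≤ M := by
    intro θ hθ
    have e : ∑ x, g x * (psi θ * vfun F θ x) = psi θ * ∑ x, vfun F θ x * g x := by
      rw [Finset.mul_sum]; exact Finset.sum_congr rfl fun x _ => by ring
    have hH : |∑ x, vfun F θ x * g x| ≤ M := by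
      refine le_trans ?_ (hM θ)
      have a1 := Real.inner_le_Lp_mul_Lq univ (vfun F θ) g hpq
      have a2 := Real.inner_le_Lp_mul_Lq univ (fun x => - vfun F θ x) g hpq
      simp only [hg1, Real.one_rpow, mul_one, abs_neg, neg_mul, Finset.sum_neg_distrib] at a1 a2
      exact abs_le.2 ⟨by unfold lpn; linarith, a1⟩
    rw [e, Real.norm_eq_abs, abs_mul]
    calc |psi θ| * |∑ x, vfun F θ x * g x| ≤ 1 * M :=
          mul_le_mul (psi_le hθ) hH (abs_nonneg _) zero_le_one
      _ = M := one_mul _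
  have hi := norm_setIntegral_le_of_norm_le_const (μ := volume) (s := Set.Ioo 0 Real.pi)
    (by simp) hb
  rw [h.2] at hi
  have e2 : ∑ x, g x * w x = lpn p w := by
    rw [← hg2]; exact Finset.sum_congr rfl fun x _ => by ring
  rw [e2, Real.norm_of_nonneg h0.le] at hi
  have hv : (volume : Measure ℝ).real (Set.Ioo 0 Real.pi) = Real.pi := by
    simp [Measure.real, Real.volume_Ioo, Real.pi_pos.le]
  rw [hv] at hi
  linarith

lemma HH_le {F : Fin n → Cube n → ℝ} {U : Matrix (Cube n) (Cube n) ℂ} (hU : IsU U)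
    {l : Cube n → ℝ} (hS : fc U l = ∑ i, Am F i) {p : ℝ} (hp : 2 ≤ p) :
    lpn p (HH F) ≤ 4 * p * lpn p l := by
  have hW : IsU (Wm n)ᴴ := by
    have := Wm_unit n
    exact ⟨by rw [conjTranspose_conjTranspose]; exact this.2,
      by rw [conjTranspose_conjTranspose]; exact this.1⟩
  have h := hilbert_diag dg (hW.mul hU) (Wm_unit n) hp l
  rw [← fc_conj, conjTranspose_conjTranspose, hS] at h
  exact h

lemma main_lpn {F : Fin n → Cube n → ℝ} (hF : ∀ i y, F i (flipCoord i y) = - F i y)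
    {p : ℝ} (hp : 2 ≤ p) :
    lpn p (fun x => ∑ i, lapPow (-(1 / 2)) (F i) x) ≤
      100 * p ^ ((3 : ℝ) / 2) * lpn p (fun x => Real.sqrt (∑ i, F i x ^ 2)) := by
  obtain ⟨U, hU, l, hl⟩ := spectral (X := ∑ i, Am F i) (by
    unfold Matrix.IsHermitian
    rw [conjTranspose_sum]
    exact Finset.sum_congr rfl fun i _ => Am_herm hF i)
  have hS : fc U l = ∑ i, Am F i := hl.symm
  have hp0 : 0 < p := by linarith
  set out : Cube n → ℝ := fun x => ∑ i, lapPow (-(1 / 2)) (F i) x with hout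
  set w : Cube n → ℝ := fun x => Real.sqrt (Real.pi / 2) * out x + Real.pi / 2 * HH F x with hwdef
  have h1 : lpn p w ≤ Real.pi * lpn p l :=
    mink hp w (fun x => psi_int hF x) (fun θ => vfun_le hF hU hS (by linarith) θ)
  have h2 := HH_le (F := F) hU hS hp
  have h3 := S_bound hF hU hS hp
  set L := lpn p l
  set R := lpn p (fun x => Real.sqrt (∑ i, F i x ^ 2))
  have hL0 : 0 ≤ L := lpn_nonneg _ _
  have hR0 : 0 ≤ R := lpn_nonneg _ _
  have hsq : 1 ≤ Real.sqrt (Real.pi / 2) :=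
    Real.one_le_sqrt.2 (by linarith [Real.pi_gt_three])
  have htri : lpn p (fun x => Real.sqrt (Real.pi / 2) * out x)
      ≤ lpn p w + lpn p (fun x => (-(Real.pi / 2)) * HH F x) := by
    have := Real.Lp_add_le univ w (fun x => (-(Real.pi / 2)) * HH F x) (p := p) (by linarith)
    have e : ∀ x, w x + -(Real.pi / 2) * HH F x = Real.sqrt (Real.pi / 2) * out x := by
      intro x; simp only [hwdef]; ring
    simp only [e] at this
    exact this
  rw [lpn_smul hp0, lpn_smul hp0, abs_neg, abs_of_nonneg (by positivity),
    abs_of_nonneg (by positivity)] at htri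
  have ho : 0 ≤ lpn p out := lpn_nonneg _ _
  have hpi := Real.pi_pos
  have hpi4 := Real.pi_le_four
  have hA : lpn p out ≤ 4 * L + 2 * (4 * p * L) := by
    calc lpn p out ≤ Real.sqrt (Real.pi / 2) * lpn p out := le_mul_of_one_le_left ho hsq
      _ ≤ lpn p w + Real.pi / 2 * lpn p (HH F) := htri
      _ ≤ Real.pi * L + Real.pi / 2 * (4 * p * L) := by gcongr
      _ ≤ 4 * L + 2 * (4 * p * L) := by
        gcongr; linarith
  have hB : lpn p out ≤ 10 * p * L := by nlinarith
  have hsp : Real.sqrt (2 * p) ≤ 2 * Real.sqrt p := by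
    rw [Real.sqrt_mul (by norm_num)]
    gcongr
    rw [Real.sqrt_le_left (by norm_num)]; norm_num
  have hpp : p * Real.sqrt p = p ^ ((3 : ℝ) / 2) := by
    rw [Real.sqrt_eq_rpow]
    nth_rewrite 1 [← Real.rpow_one p]
    rw [← Real.rpow_add hp0]; norm_num
  calc lpn p out ≤ 10 * p * L := hB
    _ ≤ 10 * p * (2 * Real.sqrt p * R) := by
      gcongr
      exact h3.trans (by gcongr)
    _ = 20 * (p * Real.sqrt p) * R := by ring
    _ = 20 * p ^ ((3 : ℝ) / 2) * R := by rw [hpp]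
    _ ≤ 100 * p ^ ((3 : ℝ) / 2) * R := by gcongr; norm_num

lemma cubeAvg_lpn {p : ℝ} (u : Cube n → ℝ) :
    (cubeAvg (fun ε => |u ε| ^ p)) ^ (1 / p) = (((2 : ℝ) ^ n)⁻¹) ^ (1 / p) * lpn p u := by
  unfold cubeAvg lpn
  rw [smul_eq_mul, Real.mul_rpow (by positivity)
    (Finset.sum_nonneg fun _ _ => Real.rpow_nonneg (abs_nonneg _) _)]

end EPR

end

/-- the endpoint scalar inequality
`‖Σ Δ^{-1/2} D_i f_i‖_p ≤ C p^{3/2} ‖(Σ (D_i f_i)²)^{1/2}‖_p`, `p ≥ 2`. -/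
theorem endpoint_scalar_riesz :
    ∃ C : ℝ, ∀ (p : ℝ), 2 ≤ p →
      ∀ (n : ℕ) (f : Fin n → (Fin n → Bool) → ℝ),
        (cubeAvg (fun ε => |∑ i, lapPow (-(1 / 2)) (Dop i (f i)) ε| ^ p)) ^ (1 / p) ≤
          C * p ^ ((3 : ℝ) / 2) *
            (cubeAvg (fun ε =>
              (Real.sqrt (∑ i, (Dop i (f i) ε) ^ 2)) ^ p)) ^ (1 / p) := by
  refine ⟨100, fun p hp n f => ?_⟩
  have h := EPR.main_lpn (F := fun i => Dop i (f i)) (fun i y => EPR.Dop_odd i (f i) y) hp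
  have e1 := EPR.cubeAvg_lpn (p := p) (fun ε => ∑ i, lapPow (-(1 / 2)) (Dop i (f i)) ε)
  have e2 := EPR.cubeAvg_lpn (p := p) (fun ε => Real.sqrt (∑ i, (Dop i (f i) ε) ^ 2))
  simp only [abs_of_nonneg (Real.sqrt_nonneg _)] at e2
  rw [e1, e2]
  calc _ ≤ (((2 : ℝ) ^ n)⁻¹) ^ (1 / p) * (100 * p ^ ((3 : ℝ) / 2) *
        EPR.lpn p (fun ε => Real.sqrt (∑ i, (Dop i (f i) ε) ^ 2))) :=
        mul_le_mul_of_nonneg_left h (by positivity)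
    _ = _ := by ring

end
end
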